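/- arXiv:1907.06448 — 7 statements merged into one kernel-verified Lean document; each statement's English description precedes it below -/
import Mathlib

section
/- Let Λ be an Artin algebra, let I be a finitely generated injective left Λ-module with projective dimension at most m, and suppose that I-domdim Λ ≥ n+1 for some n with m ≤ n. Then a finitely generated injective Λ-module J has projective dimension at most m if and only if J lies in add I. -/
open CategoryTheory

universe u

noncomputable instance hasExtModuleCat (A : Type u) [Ring A] : HasExt.{u+1} (ModuleCat.{u} A) :=
  letI := HasDerivedCategory.standard (ModuleCat.{u} A)
  hasExt_of_hasDerivedCategory _

/-- `Ext^i_A(X, Y) = 0`. -/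
def ExtVanishes (A : Type u) [Ring A] (X Y : Type u) [AddCommGroup X] [Module A X]
    [AddCommGroup Y] [Module A Y] (i : ℕ) : Prop :=
  Subsingleton (Abelian.Ext (ModuleCat.of A X) (ModuleCat.of A Y) i)

/-- `X ∈ add M`: `X` is a direct summand of a finite direct sum of copies of `M`. -/
def InAdd (Λ : Type u) [Ring Λ] (M : Type u) [AddCommGroup M] [Module Λ M]
    (X : Type u) [AddCommGroup X] [Module Λ X] : Prop :=
  ∃ (k : ℕ) (ι : X →ₗ[Λ] (Fin k → M)) (π : (Fin k → M) →ₗ[Λ] X), π ∘ₗ ι = LinearMap.id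

/-- `I`-domdim of `Y` is at least `t`: there is an exact sequence
`0 → Y → J_0 → ⋯ → J_{t-1}` with all `J_i ∈ add I`. -/
def IDomdimGE (Λ : Type u) [Ring Λ] (I : Type u) [AddCommGroup I] [Module Λ I]
    (Y : Type u) [AddCommGroup Y] [Module Λ Y] (t : ℕ) : Prop :=
  ∃ (J : ℕ → ModuleCat.{u} Λ) (g : Y →ₗ[Λ] J 0) (f : ∀ i, (J i : Type u) →ₗ[Λ] J (i+1)),
    (∀ i < t, InAdd Λ I (J i)) ∧
    (1 ≤ t → Function.Injective g) ∧
    (2 ≤ t → Function.Exact g (f 0)) ∧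
    (∀ i, i + 3 ≤ t → Function.Exact (f i) (f (i+1)))

/-- The projective dimension of `N` is at most `m`: there is a projective resolution
`0 → P_m → ⋯ → P_0 → N → 0`. -/
def ProjDimLE (Λ : Type u) [Ring Λ] (N : Type u) [AddCommGroup N] [Module Λ N] (m : ℕ) : Prop :=
  ∃ (P : ℕ → ModuleCat.{u} Λ) (f : ∀ i, (P (i+1) : Type u) →ₗ[Λ] P i) (g : (P 0 : Type u) →ₗ[Λ] N),
    (∀ i, Module.Projective Λ (P i)) ∧
    (∀ i, m < i → Subsingleton (P i)) ∧
    Function.Surjective g ∧ Function.Exact (f 0) g ∧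
    (∀ i, Function.Exact (f (i+1)) (f i))

/-- The injective dimension of `N` is at most `m`: there is an injective coresolution
`0 → N → J_0 → ⋯ → J_m → 0`. -/
def InjDimLE (Λ : Type u) [Ring Λ] (N : Type u) [AddCommGroup N] [Module Λ N] (m : ℕ) : Prop :=
  ∃ (J : ℕ → ModuleCat.{u} Λ) (g : N →ₗ[Λ] J 0) (f : ∀ i, (J i : Type u) →ₗ[Λ] J (i+1)),
    (∀ i, Module.Injective Λ (J i)) ∧
    (∀ i, m < i → Subsingleton (J i)) ∧
    Function.Injective g ∧ Function.Exact g (f 0) ∧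
    (∀ i, Function.Exact (f i) (f (i+1)))

/-- `M` is a cogenerator: every finitely generated module embeds into a finite
direct sum of copies of `M`. -/
def IsCogenerator (A : Type u) [Ring A] (M : Type u) [AddCommGroup M] [Module A M] : Prop :=
  ∀ (X : Type u) [AddCommGroup X] [Module A X], Module.Finite A X →
    ∃ (k : ℕ) (f : X →ₗ[A] (Fin k → M)), Function.Injective f

/-- `M`-codim `A ≤ m`: there is an exact sequence `0 → A → M_0 → ⋯ → M_m → 0` with all
`M_i ∈ add M` which stays exact after applying `Hom_A(-, M)`. -/
def MCodimLE (A : Type u) [Ring A] (M : Type u) [AddCommGroup M] [Module A M] (m : ℕ) : Prop :=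
  ∃ (C : ℕ → ModuleCat.{u} A) (g : A →ₗ[A] C 0) (f : ∀ i, (C i : Type u) →ₗ[A] C (i+1)),
    (∀ i ≤ m, InAdd A M (C i)) ∧
    (∀ i, m < i → Subsingleton (C i)) ∧
    Function.Injective g ∧ Function.Exact g (f 0) ∧
    (∀ i, Function.Exact (f i) (f (i+1))) ∧
    Function.Surjective (fun φ : (C 0 : Type u) →ₗ[A] M => φ ∘ₗ g) ∧
    Function.Exact (fun φ : (C 1 : Type u) →ₗ[A] M => φ ∘ₗ (f 0))
      (fun φ : (C 0 : Type u) →ₗ[A] M => φ ∘ₗ g) ∧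
    (∀ i, Function.Exact (fun φ : (C (i+2) : Type u) →ₗ[A] M => φ ∘ₗ (f (i+1)))
      (fun φ : (C (i+1) : Type u) →ₗ[A] M => φ ∘ₗ (f i)))

/-- The canonical ring homomorphism from `Λ` to the endomorphism ring of `I` over
`End_Λ(I)`, sending `λ` to multiplication by `λ`. -/
@[simps] def evalRingHom (Λ : Type u) [Ring Λ] (I : Type u) [AddCommGroup I] [Module Λ I] :
    Λ →+* Module.End (Module.End Λ I) I where
  toFun a :=
    { toFun := fun x => a • x
      map_add' := fun x y => smul_add a x y
      map_smul' := fun φ x => (φ.map_smul a x).symm }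
  map_one' := by ext x; simp
  map_mul' a b := by ext x; simp [mul_smul]
  map_zero' := by ext x; simp
  map_add' a b := by ext x; simp [add_smul]

section ExtVanishing

/-- `Ext^i_Λ(T, X) = 0` for all `i < t`. -/
def ExtVanishesBelow (Λ : Type u) [Ring Λ] (T : Type u) [AddCommGroup T] [Module Λ T]
    (X : Type u) [AddCommGroup X] [Module Λ X] (t : ℕ) : Prop :=
  ∀ i < t, ExtVanishes Λ T X i

variable {Λ : Type u} [Ring Λ]

theorem ModuleCat.shortExact_ofHom {X Y Z : Type u} [AddCommGroup X] [Module Λ X]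
    [AddCommGroup Y] [Module Λ Y] [AddCommGroup Z] [Module Λ Z] (f : X →ₗ[Λ] Y) (g : Y →ₗ[Λ] Z)
    (hf : Function.Injective f) (hg : Function.Surjective g) (h : Function.Exact f g) :
    (ShortComplex.mk (ModuleCat.ofHom f) (ModuleCat.ofHom g)
      (by ext x; exact h.apply_apply_eq_zero x)).ShortExact where
  exact := (ShortComplex.ShortExact.moduleCat_exact_iff_function_exact _).2 h
  mono_f := (ModuleCat.mono_iff_injective _).2 hf
  epi_g := (ModuleCat.epi_iff_surjective _).2 hg

variable {T : Type u} [AddCommGroup T] [Module Λ T]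

theorem extVanishes_zero_iff {X : Type u} [AddCommGroup X] [Module Λ X] :
    ExtVanishes Λ T X 0 ↔ ∀ f : T →ₗ[Λ] X, f = 0 := by
  refine ⟨fun h f => ?_, fun h => ⟨fun a b => ?_⟩⟩
  · have : Subsingleton (ModuleCat.of Λ T ⟶ ModuleCat.of Λ X) :=
      have : Subsingleton (Abelian.Ext (ModuleCat.of Λ T) (ModuleCat.of Λ X) 0) := h
      Abelian.Ext.homEquiv₀.symm.injective.subsingleton
    exact congrArg ModuleCat.Hom.hom (Subsingleton.elim (ModuleCat.ofHom f) (ModuleCat.ofHom 0))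
  · apply Abelian.Ext.homEquiv₀.injective
    exact ModuleCat.hom_ext ((h (Abelian.Ext.homEquiv₀ a).hom).trans
      (h (Abelian.Ext.homEquiv₀ b).hom).symm)

theorem extVanishes_of_injective {X : Type u} [AddCommGroup X] [Module Λ X]
    (hX : Module.Injective Λ X) (h : ∀ f : T →ₗ[Λ] X, f = 0) (i : ℕ) : ExtVanishes Λ T X i := by
  cases i with
  | zero => exact extVanishes_zero_iff.2 h
  | succ i =>
    have := Module.injective_object_of_injective_module Λ X
    exact Abelian.Ext.subsingleton_of_injective _ _ _

theorem ExtVanishes.of_retract {X Y : Type u} [AddCommGroup X] [Module Λ X] [AddCommGroup Y]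
    [Module Λ Y] (s : X →ₗ[Λ] Y) (r : Y →ₗ[Λ] X) (hrs : r ∘ₗ s = LinearMap.id) {i : ℕ}
    (h : ExtVanishes Λ T Y i) : ExtVanishes Λ T X i := by
  have key : ∀ x : Abelian.Ext (ModuleCat.of Λ T) (ModuleCat.of Λ X) i, x = 0 := fun x => by
    have hid : ModuleCat.ofHom s ≫ ModuleCat.ofHom r = 𝟙 (ModuleCat.of Λ X) := by
      rw [← ModuleCat.ofHom_comp, hrs]; rfl
    have h0 : x.comp (Abelian.Ext.mk₀ (ModuleCat.ofHom s)) (add_zero i) = 0 := h.elim _ _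
    rw [← x.comp_mk₀_id, ← hid, ← Abelian.Ext.mk₀_comp_mk₀,
      ← Abelian.Ext.comp_assoc_of_third_deg_zero, h0, Abelian.Ext.zero_comp]
  exact ⟨fun a b => by rw [key a, key b]⟩

section ShortExact

variable {X Y Z : Type u} [AddCommGroup X] [Module Λ X] [AddCommGroup Y] [Module Λ Y]
  [AddCommGroup Z] [Module Λ Z] {f : X →ₗ[Λ] Y} {g : Y →ₗ[Λ] Z}

theorem ExtVanishesBelow.left {t : ℕ} (hf : Function.Injective f) (hg : Function.Surjective g)
    (h : Function.Exact f g) (hY : ExtVanishesBelow Λ T Y (t + 1)) (hZ : ExtVanishesBelow Λ T Z t) :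
    ExtVanishesBelow Λ T X (t + 1) := by
  have hS := ModuleCat.shortExact_ofHom f g hf hg h
  rintro (_ | i) hi
  · rw [extVanishes_zero_iff]
    intro φ
    have := extVanishes_zero_iff.1 (hY 0 hi) (f ∘ₗ φ)
    ext x
    exact hf (by simpa using LinearMap.congr_fun this x)
  · have key : ∀ x : Abelian.Ext (ModuleCat.of Λ T) (ModuleCat.of Λ X) (i + 1), x = 0 := fun x => by
      obtain ⟨y, rfl⟩ := Abelian.Ext.covariant_sequence_exact₁ _ hS x
        ((hY (i + 1) hi).elim _ _) rfl
      rw [(hZ i (by omega)).elim y 0, Abelian.Ext.zero_comp]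
    exact ⟨fun a b => by rw [key a, key b]⟩

theorem ExtVanishesBelow.right {t : ℕ} (hf : Function.Injective f) (hg : Function.Surjective g)
    (h : Function.Exact f g) (hX : ExtVanishesBelow Λ T X (t + 1)) (hY : ExtVanishesBelow Λ T Y t) :
    ExtVanishesBelow Λ T Z t := by
  have hS := ModuleCat.shortExact_ofHom f g hf hg h
  intro i hi
  have key : ∀ x : Abelian.Ext (ModuleCat.of Λ T) (ModuleCat.of Λ Z) i, x = 0 := fun x => by
    obtain ⟨y, rfl⟩ := Abelian.Ext.covariant_sequence_exact₃ _ hS x rfl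
      ((hX (i + 1) (by omega)).elim _ _)
    rw [(hY i hi).elim y 0, Abelian.Ext.zero_comp]
  exact ⟨fun a b => by rw [key a, key b]⟩

end ShortExact

end ExtVanishing

section Injective

variable {Λ : Type u} [Ring Λ]

/-- Over a Noetherian ring, direct sums of copies of an injective module are injective. -/
theorem Module.Injective.finsupp [IsNoetherianRing Λ] {M : Type u} [AddCommGroup M] [Module Λ M]
    (hM : Module.Injective Λ M) (ι : Type u) : Module.Injective Λ (ι →₀ M) := by
  classical
  apply Module.Baer.injective
  intro a g
  obtain ⟨S, hS⟩ : (LinearMap.range g).FG := by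
    rw [LinearMap.range_eq_map]; exact (IsNoetherian.noetherian (⊤ : Submodule Λ a)).map g
  let s : Finset ι := S.biUnion Finsupp.support
  have hs : LinearMap.range g ≤ Finsupp.supported M Λ (s : Set ι) := by
    rw [← hS, Submodule.span_le]
    intro x hx i hi
    exact Finset.mem_coe.2 (Finset.mem_biUnion.2 ⟨x, hx, hi⟩)
  choose G hG using fun i => Module.Baer.of_injective hM a (Finsupp.lapply i ∘ₗ g)
  refine ⟨∑ i ∈ s, Finsupp.lsingle i ∘ₗ G i, fun x hx => ?_⟩
  have hsupp : (g ⟨x, hx⟩).support ⊆ s := fun i hi => hs ⟨_, rfl⟩ hi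
  rw [LinearMap.sum_apply]
  conv_rhs => rw [← Finsupp.sum_single (g ⟨x, hx⟩), Finsupp.sum_of_support_subset _ hsupp _ (by simp)]
  refine Finset.sum_congr rfl fun i _ => ?_
  simp [hG i x hx]

variable {I X : Type u} [AddCommGroup I] [Module Λ I] [AddCommGroup X] [Module Λ X]

theorem InAdd.injective (hI : Module.Injective Λ I) (h : InAdd Λ I X) : Module.Injective Λ X := by
  obtain ⟨k, s, r, hrs⟩ := h
  refine ⟨fun A B _ _ _ _ f hf g => ?_⟩
  have : Module.Injective Λ (Fin k → I) := Module.Injective.pi ..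
  obtain ⟨e, he⟩ := Module.Injective.out f hf (s ∘ₗ g)
  exact ⟨r ∘ₗ e, fun x => by simpa [he] using LinearMap.congr_fun hrs (g x)⟩

theorem InAdd.hom_eq_zero {T : Type u} [AddCommGroup T] [Module Λ T] (h : InAdd Λ I X)
    (hT : ∀ f : T →ₗ[Λ] I, f = 0) (f : T →ₗ[Λ] X) : f = 0 := by
  obtain ⟨k, s, r, hrs⟩ := h
  have hsf : s ∘ₗ f = 0 := by
    ext x i
    exact LinearMap.congr_fun (hT (LinearMap.proj i ∘ₗ s ∘ₗ f)) x
  rw [← LinearMap.id_comp f, ← hrs, LinearMap.comp_assoc, hsf, LinearMap.comp_zero]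

theorem InAdd.extVanishes_finsupp [IsNoetherianRing Λ] {T : Type u} [AddCommGroup T] [Module Λ T]
    (h : InAdd Λ I X) (hI : Module.Injective Λ I) (hT : ∀ f : T →ₗ[Λ] I, f = 0) (ι : Type u)
    (i : ℕ) : ExtVanishes Λ T (ι →₀ X) i := by
  refine extVanishes_of_injective ((h.injective hI).finsupp ι) (fun f => ?_) i
  ext x j
  exact LinearMap.congr_fun (h.hom_eq_zero hT (Finsupp.lapply j ∘ₗ f)) x

end Injective

section DominantDimension

variable {Λ : Type u} [Ring Λ] {I : Type u} [AddCommGroup I] [Module Λ I]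

theorem IDomdimGE.exists_cokernel {Y : Type u} [AddCommGroup Y] [Module Λ Y] {t : ℕ}
    (h : IDomdimGE Λ I Y (t + 1)) :
    ∃ (E : ModuleCat.{u} Λ) (g : Y →ₗ[Λ] E), InAdd Λ I E ∧ Function.Injective g ∧
      IDomdimGE Λ I (E ⧸ LinearMap.range g) t := by
  obtain ⟨J, g, f, hJ, hg, hgf, hf⟩ := h
  refine ⟨J 0, g, hJ 0 (by omega), hg (by omega), ?_⟩
  by_cases ht : t = 0
  · subst ht
    exact ⟨J, 0, f, by simp, by simp, by simp, by simp⟩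
  have hgf := hgf (by omega)
  have hle : LinearMap.range g ≤ LinearMap.ker (f 0) := (LinearMap.exact_iff.1 hgf).ge
  refine ⟨fun i => J (i + 1), (LinearMap.range g).liftQ (f 0) hle, fun i => f (i + 1),
    fun i hi => hJ _ (by omega), fun _ => ?_, fun h2 => ?_, fun i hi => hf _ (by omega)⟩
  · rw [← LinearMap.ker_eq_bot]
    exact Submodule.ker_liftQ_eq_bot _ _ _ (LinearMap.exact_iff.1 hgf).le
  · have := hf 0 (by omega)
    rw [LinearMap.exact_iff] at this ⊢
    rw [Submodule.range_liftQ]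
    exact this

theorem IDomdimGE.extVanishesBelow_finsupp [IsNoetherianRing Λ] (hI : Module.Injective Λ I)
    {T : Type u} [AddCommGroup T] [Module Λ T] (hT : ∀ f : T →ₗ[Λ] I, f = 0) (ι : Type u) {t : ℕ}
    {Y : Type u} [AddCommGroup Y] [Module Λ Y] (h : IDomdimGE Λ I Y t) :
    ExtVanishesBelow Λ T (ι →₀ Y) t := by
  induction t generalizing Y with
  | zero => exact fun i hi => absurd hi (Nat.not_lt_zero i)
  | succ t ih =>
    obtain ⟨E, g, hE, hg, hC⟩ := h.exists_cokernel
    refine ExtVanishesBelow.left (f := Finsupp.mapRange.linearMap g)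
      (g := Finsupp.mapRange.linearMap (LinearMap.range g).mkQ)
      (Finsupp.mapRange_injective _ (map_zero g) hg)
      (Finsupp.mapRange_surjective _ (map_zero _) (Submodule.mkQ_surjective _)) ?_
      (fun i _ => hE.extVanishes_finsupp hI hT ι i) (ih hC)
    rw [LinearMap.exact_iff, Finsupp.ker_mapRange, Finsupp.range_mapRange_linearMap _
      (LinearMap.ker_eq_bot.2 hg), Submodule.ker_mkQ]

theorem extVanishesBelow_of_projective {T : Type u} [AddCommGroup T] [Module Λ T] {t : ℕ}
    (h : ∀ ι : Type u, ExtVanishesBelow Λ T (ι →₀ Λ) t) {P : Type u} [AddCommGroup P] [Module Λ P]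
    (hP : Module.Projective Λ P) : ExtVanishesBelow Λ T P t := by
  obtain ⟨s, hs⟩ := (Module.projective_def' (R := Λ) (P := P)).1 hP
  exact fun i hi => (h P i hi).of_retract s _ hs

end DominantDimension

section ProjectiveDimension

variable {Λ : Type u} [Ring Λ]

theorem ProjDimLE.projective {X : Type u} [AddCommGroup X] [Module Λ X]
    (h : ProjDimLE Λ X 0) : Module.Projective Λ X := by
  obtain ⟨P, f, g, hP, hP0, hg, hfg, -⟩ := h
  have := hP0 1 one_pos
  have hinj : Function.Injective g := by
    rw [← LinearMap.ker_eq_bot, LinearMap.exact_iff.1 hfg, LinearMap.range_eq_bot]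
    ext x
    rw [Subsingleton.elim x 0, map_zero, map_zero]
  have := hP 0
  exact Module.Projective.of_equiv' (LinearEquiv.ofBijective g ⟨hinj, hg⟩)

theorem ProjDimLE.exists_kernel {X : Type u} [AddCommGroup X] [Module Λ X] {m : ℕ}
    (h : ProjDimLE Λ X (m + 1)) :
    ∃ (P : ModuleCat.{u} Λ) (g : P →ₗ[Λ] X), Module.Projective Λ P ∧ Function.Surjective g ∧
      ProjDimLE Λ (LinearMap.ker g) m := by
  obtain ⟨P, f, g, hP, hP0, hg, hfg, hf⟩ := h
  have hker := LinearMap.exact_iff.1 hfg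
  refine ⟨P 0, g, hP 0, hg, fun i => P (i + 1), fun i => f (i + 1),
    (f 0).codRestrict _ fun x => LinearMap.mem_ker.2 (hfg.apply_apply_eq_zero x), fun i => hP _,
    fun i hi => hP0 _ (by omega), ?_, ?_, fun i => hf _⟩
  · rintro ⟨x, hx⟩
    obtain ⟨y, rfl⟩ := (hfg x).1 hx
    exact ⟨y, rfl⟩
  · have := LinearMap.exact_iff.1 (hf 0)
    exact LinearMap.exact_iff.2 ((LinearMap.ker_codRestrict _ _ _).trans this)

theorem ProjDimLE.of_projective {X : Type u} [AddCommGroup X] [Module Λ X]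
    (hX : Module.Projective Λ X) : ProjDimLE Λ X 0 := by
  refine ⟨fun i => Nat.casesOn i (ModuleCat.of Λ X) fun _ => ModuleCat.of Λ PUnit.{u + 1}, fun i => 0,
    LinearMap.id, ?_, ?_, Function.surjective_id, ?_, ?_⟩
  · rintro (_ | i)
    · exact hX
    · exact inferInstanceAs (Module.Projective Λ PUnit.{u + 1})
  · rintro (_ | i) hi
    · exact absurd hi (lt_irrefl _)
    · exact inferInstanceAs (Subsingleton PUnit.{u + 1})
  · intro x
    exact ⟨fun hx => ⟨0, hx.symm⟩, fun ⟨y, hy⟩ => hy.symm⟩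
  · intro i x
    exact ⟨fun _ => ⟨0, rfl⟩, fun _ => rfl⟩

theorem ProjDimLE.of_kernel {X P : Type u} [AddCommGroup X] [Module Λ X] [AddCommGroup P]
    [Module Λ P] (hP : Module.Projective Λ P) {g : P →ₗ[Λ] X} (hg : Function.Surjective g) {m : ℕ}
    (h : ProjDimLE Λ (LinearMap.ker g) m) : ProjDimLE Λ X (m + 1) := by
  obtain ⟨Q, f, q, hQ, hQ0, hq, hfq, hf⟩ := h
  refine ⟨fun i => Nat.casesOn i (ModuleCat.of Λ P) Q,
    fun i => Nat.casesOn i ((LinearMap.ker g).subtype ∘ₗ q) f, g, ?_, ?_, hg, ?_, ?_⟩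
  · rintro (_ | i)
    · exact hP
    · exact hQ i
  · rintro (_ | i) hi
    · omega
    · exact hQ0 i (by omega)
  · rw [LinearMap.exact_iff]
    change LinearMap.ker g = LinearMap.range ((LinearMap.ker g).subtype ∘ₗ q)
    rw [LinearMap.range_comp_of_range_eq_top _ (LinearMap.range_eq_top.2 hq),
      Submodule.range_subtype]
  · rintro (_ | i)
    · rw [LinearMap.exact_iff] at hfq ⊢
      change LinearMap.ker ((LinearMap.ker g).subtype ∘ₗ q) = LinearMap.range (f 0)
      rw [LinearMap.ker_comp_of_ker_eq_bot _ (Submodule.ker_subtype _), hfq]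
    · exact hf i

theorem projDimLE_iff {X : Type u} [AddCommGroup X] [Module Λ X] {m : ℕ} :
    ProjDimLE Λ X m ↔ HasProjectiveDimensionLE (ModuleCat.of Λ X) m := by
  induction m generalizing X with
  | zero =>
    rw [← projective_iff_hasProjectiveDimensionLE_zero, ← IsProjective.iff_projective]
    exact ⟨fun h => h.projective, ProjDimLE.of_projective⟩
  | succ m ih =>
    have key {P : Type u} [AddCommGroup P] [Module Λ P] (hP : Module.Projective Λ P)
        {g : P →ₗ[Λ] X} (hg : Function.Surjective g) :
        HasProjectiveDimensionLE (ModuleCat.of Λ X) (m + 1) ↔ ProjDimLE Λ (LinearMap.ker g) m := by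
      rw [ih]
      exact (ModuleCat.shortExact_ofHom (LinearMap.ker g).subtype g Subtype.val_injective hg
        g.exact_subtype_ker_map).hasProjectiveDimensionLT_X₃_iff m
          ((IsProjective.iff_projective P).1 hP)
    constructor
    · intro h
      obtain ⟨P, g, hP, hg, hK⟩ := h.exists_kernel
      exact (key hP hg).2 hK
    · intro h
      have hg := Finsupp.linearCombination_id_surjective Λ X
      exact .of_kernel inferInstance hg ((key inferInstance hg).1 h)

theorem ProjDimLE.pi {X : Type u} [AddCommGroup X] [Module Λ X] {m : ℕ} (h : ProjDimLE Λ X m)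
    (k : ℕ) : ProjDimLE Λ (Fin k → X) m := by
  obtain ⟨P, f, g, hP, hP0, hg, hfg, hf⟩ := h
  have compLeft_exact {A B C : Type u} [AddCommGroup A] [Module Λ A] [AddCommGroup B] [Module Λ B]
      [AddCommGroup C] [Module Λ C] {a : A →ₗ[Λ] B} {b : B →ₗ[Λ] C} (h : Function.Exact a b) :
      Function.Exact (a.compLeft (Fin k)) (b.compLeft (Fin k)) := fun x => by
    simp only [funext_iff, Set.mem_range, LinearMap.compLeft_apply, Function.comp_apply,
      Pi.zero_apply, h _]
    exact ⟨fun h => ⟨fun i => (h i).choose, fun i => (h i).choose_spec⟩,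
      fun ⟨y, hy⟩ i => ⟨y i, hy i⟩⟩
  refine ⟨fun i => ModuleCat.of Λ (Fin k → P i), fun i => (f i).compLeft (Fin k),
    g.compLeft (Fin k), fun i => ?_, fun i hi => ?_, hg.comp_left, compLeft_exact hfg,
    fun i => compLeft_exact (hf i)⟩
  · have := hP i
    exact Module.Projective.of_equiv' (DFinsupp.linearEquivFunOnFintype (R := Λ)
      (M := fun _ : Fin k => P i))
  · have := hP0 i hi
    exact inferInstanceAs (Subsingleton (Fin k → P i))

theorem InAdd.projDimLE {I X : Type u} [AddCommGroup I] [Module Λ I] [AddCommGroup X] [Module Λ X]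
    {m : ℕ} (h : InAdd Λ I X) (hI : ProjDimLE Λ I m) : ProjDimLE Λ X m := by
  obtain ⟨k, s, r, hrs⟩ := h
  have := projDimLE_iff.1 (hI.pi k)
  let e : Retract (ModuleCat.of Λ X) (ModuleCat.of Λ (Fin k → I)) :=
    { i := ModuleCat.ofHom s
      r := ModuleCat.ofHom r
      retract := by rw [← ModuleCat.ofHom_comp, hrs]; rfl }
  exact projDimLE_iff.2 (e.hasProjectiveDimensionLT _)

theorem ProjDimLE.extVanishesBelow {T : Type u} [AddCommGroup T] [Module Λ T] {m t : ℕ}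
    (hproj : ∀ (P : Type u) [AddCommGroup P] [Module Λ P], Module.Projective Λ P →
      ExtVanishesBelow Λ T P (t + m)) {X : Type u} [AddCommGroup X] [Module Λ X]
    (h : ProjDimLE Λ X m) : ExtVanishesBelow Λ T X t := by
  induction m generalizing X t with
  | zero => exact hproj X h.projective
  | succ m ih =>
    obtain ⟨P, g, hP, hg, hK⟩ := h.exists_kernel
    refine .right Subtype.val_injective hg g.exact_subtype_ker_map
      (ih (t := t + 1) (fun Q _ _ hQ => ?_) hK) fun i hi => hproj P hP i (by omega)
    rw [add_right_comm, add_assoc]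
    exact hproj Q hQ

end ProjectiveDimension

/-- A finitely generated injective module over an Artinian ring lies in `add I` as soon as it is
cogenerated by `I`, which is tested on modules without nonzero maps to `I`. -/
theorem inAdd_of_hom_eq_zero {Λ : Type u} [Ring Λ] {I J : Type u} [AddCommGroup I] [Module Λ I]
    [AddCommGroup J] [Module Λ J] [IsArtinian Λ J] (hI : Module.Injective Λ I)
    (hJ : Module.Injective Λ J)
    (h : ∀ K : Submodule Λ J, (∀ f : K →ₗ[Λ] I, f = 0) → ∀ f : K →ₗ[Λ] J, f = 0) :
    InAdd Λ I J := by
  classical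
  obtain ⟨S, hS⟩ := Finset.exists_inf_le (fun f : J →ₗ[Λ] I => LinearMap.ker f)
  let K : Submodule Λ J := S.inf fun f => LinearMap.ker f
  have hK : K = ⊥ := by
    have hK0 := h K (fun f => ?_) K.subtype
    · rw [← Submodule.range_subtype K, hK0, LinearMap.range_zero]
    · obtain ⟨F, hF⟩ := Module.Injective.out K.subtype Subtype.val_injective f
      ext x
      rw [← hF x]
      exact hS F x.2
  let s : J →ₗ[Λ] (Fin S.card → I) := LinearMap.pi fun i => (S.equivFin.symm i : J →ₗ[Λ] I)
  have hs : Function.Injective s := by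
    rw [← LinearMap.ker_eq_bot, eq_bot_iff, ← hK]
    refine fun x hx => Submodule.mem_finsetInf.2 fun f hf => ?_
    have := congrFun (LinearMap.mem_ker.1 hx) (S.equivFin ⟨f, hf⟩)
    simpa [s] using this
  obtain ⟨r, hr⟩ := Module.Injective.out s hs (LinearMap.id : J →ₗ[Λ] J)
  exact ⟨_, s, r, LinearMap.ext hr⟩

/-- If `Λ` is an Artin algebra, `I` a finitely generated injective `Λ`-module with
projective dimension at most `m`, and `I`-domdim `Λ ≥ n+1` with `m ≤ n`, then a finitely
generated injective `Λ`-module has projective dimension at most `m` iff it lies in `add I`. -/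
theorem stmt0 (R : Type u) [CommRing R] [IsArtinianRing R]
    (Λ : Type u) [Ring Λ] [Algebra R Λ] [Module.Finite R Λ]
    (I : Type u) [AddCommGroup I] [Module Λ I] [Module.Finite Λ I]
    (hIinj : Module.Injective Λ I)
    (m n : ℕ) (hmn : m ≤ n)
    (hpd : ProjDimLE Λ I m)
    (hdom : IDomdimGE Λ I Λ (n + 1)) :
    ∀ (J : Type u) [AddCommGroup J] [Module Λ J], Module.Finite Λ J →
      Module.Injective Λ J → (ProjDimLE Λ J m ↔ InAdd Λ I J) := by
  intro J _ _ _ hJ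
  have : IsArtinianRing Λ := IsArtinianRing.of_finite R Λ
  have : IsNoetherianRing Λ := IsNoetherianRing.of_finite R Λ
  refine ⟨fun h => inAdd_of_hom_eq_zero hIinj hJ fun K hK => ?_, fun h => InAdd.projDimLE h hpd⟩
  refine extVanishes_zero_iff.1 (ProjDimLE.extVanishesBelow (t := 1) (fun P _ _ hP i hi => ?_) h 0 one_pos)
  exact extVanishesBelow_of_projective
    (fun ι => IDomdimGE.extVanishesBelow_finsupp hIinj hK ι hdom) hP i (by omega)
end

section
/- Let A be an Artin algebra, M a finitely generated A-module and Λ = End_A(M), so that M is a left Λ-module via evaluation. Assume (i) M is a cogenerator over A, (ii) Ext^i_A(M,M) = 0 for 1 ≤ i ≤ n−1 for some n ≥ 1, and (iii) M-codim A ≤ m for some m ≥ 0. Then M, viewed as a left Λ-module (canonically isomorphic to Hom_A(A,M)), is injective and has projective dimension at most m over Λ. -/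
open CategoryTheory

universe u

/-- Precomposition with `f : X →ₗ[A] Y`, as an `End_A(M)`-linear map
`Hom_A(Y, M) → Hom_A(X, M)`. -/
def precompEnd {A : Type*} [Ring A] (M : Type*) [AddCommGroup M] [Module A M]
    {X Y : Type*} [AddCommGroup X] [Module A X] [AddCommGroup Y] [Module A Y]
    (f : X →ₗ[A] Y) : (Y →ₗ[A] M) →ₗ[Module.End A M] (X →ₗ[A] M) where
  toFun φ := φ ∘ₗ f
  map_add' _ _ := rfl
  map_smul' _ _ := rfl

/-- `Hom_A(A, M)` is isomorphic to `M` over `End_A(M)`, by evaluation at `1`. -/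
def evalOneEquivEnd (A : Type*) [Ring A] (M : Type*) [AddCommGroup M] [Module A M] :
    (A →ₗ[A] M) ≃ₗ[Module.End A M] M where
  toFun φ := φ 1
  invFun x := LinearMap.toSpanSingleton A M x
  map_add' _ _ := rfl
  map_smul' _ _ := rfl
  left_inv φ := by ext; simp
  right_inv x := by simp

/-- `Hom_A(M^k, M)` is isomorphic to `End_A(M)^k` over `End_A(M)`. -/
def homPowEquivEnd (A : Type*) [Ring A] (M : Type*) [AddCommGroup M] [Module A M] (k : ℕ) :
    ((Fin k → M) →ₗ[A] M) ≃ₗ[Module.End A M] (Fin k → Module.End A M) where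
  toFun φ j := φ ∘ₗ LinearMap.single A (fun _ => M) j
  invFun ψ := ∑ j, ψ j ∘ₗ LinearMap.proj j
  map_add' _ _ := rfl
  map_smul' _ _ := rfl
  left_inv φ := by
    ext j x
    simp [Pi.single_apply, apply_ite]
  right_inv ψ := by
    ext j x
    simp [Pi.single_apply, apply_ite]

/-- If `X ∈ add M`, then `Hom_A(X, M)` is projective over `End_A(M)`. -/
theorem InAdd.projective_hom {A : Type u} [Ring A] {M : Type u} [AddCommGroup M] [Module A M]
    {X : Type u} [AddCommGroup X] [Module A X] (h : InAdd A M X) :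
    Module.Projective (Module.End A M) (X →ₗ[A] M) := by
  obtain ⟨k, ι, π, hπ⟩ := h
  have := Module.Projective.of_equiv (homPowEquivEnd A M k).symm
  refine Module.Projective.of_split (precompEnd M π) (precompEnd M ι) ?_
  ext φ x
  exact congrArg φ (LinearMap.congr_fun hπ x)

/-- Applying `Hom_A(-, M)` to a coresolution of `A` realizing `M`-codim `A ≤ m` yields a projective
resolution of `M` over `End_A(M)`. -/
theorem MCodimLE.projDimLE {A : Type u} [Ring A] {M : Type u} [AddCommGroup M] [Module A M]
    {m : ℕ} (h : MCodimLE A M m) : ProjDimLE (Module.End A M) M m := by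
  obtain ⟨C, g, f, hadd, hzero, -, -, -, hsurj, hexact, hexact'⟩ := h
  have hsub (i : ℕ) (hi : m < i) : Subsingleton ((C i : Type u) →ₗ[A] M) :=
    have := hzero i hi
    ⟨fun φ ψ => LinearMap.ext fun x => by rw [Subsingleton.elim x 0, map_zero, map_zero]⟩
  refine ⟨fun i => ModuleCat.of _ ((C i : Type u) →ₗ[A] M), fun i => precompEnd M (f i),
    (evalOneEquivEnd A M).toLinearMap ∘ₗ precompEnd M g, fun i => ?_, hsub,
    (evalOneEquivEnd A M).surjective.comp hsurj, fun φ => ?_, hexact'⟩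
  · by_cases hi : i ≤ m
    · exact (hadd i hi).projective_hom
    · have := hsub i (not_le.mp hi)
      exact Module.Projective.of_free
  · refine Iff.trans ?_ (hexact φ)
    exact (evalOneEquivEnd A M).map_eq_zero_iff (x := φ ∘ₗ g)

/-- A finitely generated module over an Artin algebra has a left Noetherian endomorphism ring. -/
theorem isNoetherianRing_end_of_finite (R : Type*) [CommRing R] [IsNoetherianRing R]
    (A : Type*) [Ring A] [Algebra R A] [Module.Finite R A]
    (M : Type*) [AddCommGroup M] [Module A M] [Module.Finite A M] :
    IsNoetherianRing (Module.End A M) := by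
  let _ : Module R M := Module.compHom M (algebraMap R A)
  have : IsScalarTower R A M :=
    ⟨fun r a x => by rw [Algebra.smul_def, mul_smul]; rfl⟩
  have : SMulCommClass A R M := IsScalarTower.to_smulCommClass'
  have : Module.Finite R M := Module.Finite.trans A M
  have : IsNoetherian R (M →ₗ[R] M) := inferInstance
  have : IsNoetherian R (Module.End A M) :=
    isNoetherian_of_injective (LinearMap.restrictScalarsₗ R A M M R)
      (LinearMap.restrictScalars_injective R)
  exact isNoetherian_of_tower R inferInstance

/-- If `M` is a cogenerator, an element of a finitely generated module that is killed by every map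
to `M` vanishing on a submodule lies in this submodule. -/
theorem IsCogenerator.mem_of_forall_hom {A : Type u} [Ring A] {M : Type u} [AddCommGroup M]
    [Module A M] (hcog : IsCogenerator A M) {X : Type u} [AddCommGroup X] [Module A X]
    [Module.Finite A X] (N : Submodule A X) (x : X)
    (h : ∀ ψ : X →ₗ[A] M, N ≤ LinearMap.ker ψ → ψ x = 0) : x ∈ N := by
  obtain ⟨k, e, he⟩ := hcog (X ⧸ N) inferInstance
  rw [← Submodule.Quotient.mk_eq_zero N]
  apply he
  rw [map_zero]
  ext j
  refine h (LinearMap.proj j ∘ₗ e ∘ₗ N.mkQ) fun y hy => ?_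
  have : N.mkQ y = 0 := (Submodule.Quotient.mk_eq_zero N).mpr hy
  simp [this]

/-- A finitely generated cogenerator is injective over its endomorphism ring, if the latter is
left Noetherian. -/
theorem IsCogenerator.injective_end {A : Type u} [Ring A] {M : Type u} [AddCommGroup M]
    [Module A M] [Module.Finite A M] [IsNoetherianRing (Module.End A M)]
    (hcog : IsCogenerator A M) : Module.Injective (Module.End A M) M := by
  refine Module.Baer.injective fun L h => ?_
  obtain ⟨r, φ, hφ⟩ := Submodule.fg_iff_exists_fin_generating_family.mp
    (IsNoetherian.noetherian L)
  have hmem (j : Fin r) : φ j ∈ L := hφ ▸ Submodule.subset_span ⟨j, rfl⟩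
  have hx : (fun j => h ⟨φ j, hmem j⟩) ∈ LinearMap.range (LinearMap.pi φ) := by
    refine hcog.mem_of_forall_hom _ _ fun ψ hψ => ?_
    set c := homPowEquivEnd A M r ψ with hc
    have hsum (x : Fin r → M) : ψ x = ∑ j, c j (x j) := by
      rw [← (homPowEquivEnd A M r).symm_apply_apply ψ, ← hc]
      simp [homPowEquivEnd]
    have hrel : ∑ j, c j • (⟨φ j, hmem j⟩ : L) = 0 := by
      ext y
      have : ψ (LinearMap.pi φ y) = 0 := hψ ⟨y, rfl⟩
      simpa [hsum] using this
    have := congrArg h hrel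
    simp only [map_sum, map_smul, map_zero] at this
    rw [hsum]
    exact this
  obtain ⟨y, hy⟩ := hx
  refine ⟨LinearMap.toSpanSingleton (Module.End A M) M y, fun a ha => ?_⟩
  obtain ⟨c, rfl⟩ := Submodule.mem_span_range_iff_exists_fun _ |>.mp (hφ ▸ ha)
  have hsum : (⟨∑ j, c j • φ j, ha⟩ : L) = ∑ j, c j • ⟨φ j, hmem j⟩ := by
    ext
    simp
  have hy' (j : Fin r) : φ j y = h ⟨φ j, hmem j⟩ := congrFun hy j
  rw [hsum]
  simp only [map_sum, map_smul, ← hy']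
  simp

/-- If `M` is a cogenerator over the Artin algebra `A` with
`Ext^i_A(M,M) = 0` for `1 ≤ i ≤ n-1` and `M`-codim `A ≤ m`, then `M`, viewed as a module over
`Λ = End_A(M)` via evaluation, is injective of projective dimension at most `m`. -/
theorem stmt1 (R : Type u) [CommRing R] [IsArtinianRing R]
    (A : Type u) [Ring A] [Algebra R A] [Module.Finite R A]
    (M : Type u) [AddCommGroup M] [Module A M] [Module.Finite A M]
    (n m : ℕ) (hn : 1 ≤ n)
    (hcog : IsCogenerator A M)
    (hext : ∀ i : ℕ, 1 ≤ i → i ≤ n - 1 → ExtVanishes A M M i)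
    (hcodim : MCodimLE A M m) :
    Module.Injective (Module.End A M) M ∧ ProjDimLE (Module.End A M) M m := by
  have := isNoetherianRing_end_of_finite R A M
  exact ⟨hcog.injective_end, hcodim.projDimLE⟩
end

section
/- Let A be an Artin algebra and T a finitely generated generator-cogenerator over A, and let Γ = End_A(T), so that T is a left Γ-module via evaluation. Then: T as a Γ-module is both projective and injective; there exists an exact sequence 0 → Γ → T_0 → T_1 of left Γ-modules with T_0, T_1 ∈ add_Γ T (so Γ has dominant dimension at least 2); and a finitely generated Γ-module is both projective and injective if and only if it lies in add_Γ T. -/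
open CategoryTheory

universe u

section InAdd

variable {Λ : Type u} [Ring Λ] {M : Type u} [AddCommGroup M] [Module Λ M]
  {X : Type u} [AddCommGroup X] [Module Λ X]

theorem InAdd.pi (k : ℕ) : InAdd Λ M (Fin k → M) :=
  ⟨k, LinearMap.id, LinearMap.id, rfl⟩

theorem InAdd.projective [Module.Projective Λ M] (h : InAdd Λ M X) : Module.Projective Λ X := by
  obtain ⟨k, i, p, hp⟩ := h
  have : Module.Projective Λ (Fin k → M) :=
    .of_equiv (DFinsupp.linearEquivFunOnFintype (R := Λ) (M := fun _ : Fin k ↦ M))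
  exact .of_split i p hp

theorem Module.Injective.of_inAdd [Module.Injective Λ M] (h : InAdd Λ M X) :
    Module.Injective Λ X := by
  obtain ⟨k, i, p, hp⟩ := h
  refine ⟨fun Y Z _ _ _ _ f hf g ↦ ?_⟩
  obtain ⟨e, he⟩ := Module.Injective.out f hf (i ∘ₗ g)
  refine ⟨p ∘ₗ e, fun y ↦ ?_⟩
  rw [LinearMap.comp_apply, he]
  exact LinearMap.congr_fun hp (g y)

/-- An injective module that embeds into a finite power of `M` lies in `add M`. -/
theorem InAdd.of_injective [Module.Injective Λ X] {κ : Type*} [Finite κ] (f : X →ₗ[Λ] κ → M)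
    (hf : Function.Injective f) : InAdd Λ M X := by
  obtain ⟨k, ⟨e⟩⟩ := Finite.exists_equiv_fin κ
  let E : (κ → M) ≃ₗ[Λ] (Fin k → M) := LinearEquiv.funCongrLeft Λ M e.symm
  obtain ⟨p, hp⟩ := Module.Injective.out (E.toLinearMap ∘ₗ f) (E.injective.comp hf) LinearMap.id
  exact ⟨k, E.toLinearMap ∘ₗ f, p, LinearMap.ext hp⟩

end InAdd

section End

variable {A : Type u} [Ring A] {T : Type u} [AddCommGroup T] [Module A T]

/-- A generator is projective over its endomorphism ring. -/
theorem projective_end_of_inAdd (hgen : InAdd A T A) : Module.Projective (Module.End A T) T := by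
  obtain ⟨k, i, p, hp⟩ := hgen
  let s : T →ₗ[Module.End A T] (Fin k → Module.End A T) :=
    { toFun := fun t j ↦ LinearMap.toSpanSingleton A T t ∘ₗ p ∘ₗ LinearMap.single A (fun _ ↦ T) j
      map_add' := fun t t' ↦ by ext; simp
      map_smul' := fun γ t ↦ by ext; simp }
  let r : (Fin k → Module.End A T) →ₗ[Module.End A T] T :=
    { toFun := fun γ ↦ ∑ j, γ j (i 1 j)
      map_add' := fun γ γ' ↦ by simp [Finset.sum_add_distrib]
      map_smul' := fun c γ ↦ by simp }
  refine .of_split s r (LinearMap.ext fun t ↦ ?_)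
  change ∑ j, p (Pi.single j (i 1 j)) • t = t
  rw [← Finset.sum_smul, ← map_sum, Finset.univ_sum_single]
  exact (congrArg (· • t) (LinearMap.congr_fun hp 1)).trans (one_smul A t)

/-- A cogenerator is injective over its endomorphism ring, if that ring is left Noetherian. -/
theorem injective_end_of_isCogenerator [Module.Finite A T] [IsNoetherianRing (Module.End A T)]
    (hcog : IsCogenerator A T) : Module.Injective (Module.End A T) T := by
  refine Module.Baer.injective fun I φ ↦ ?_
  obtain ⟨n, γ, rfl⟩ := Submodule.fg_iff_exists_fin_generating_family.mp (IsNoetherian.noetherian I)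
  have hγ j : γ j ∈ Submodule.span (Module.End A T) (Set.range γ) :=
    Submodule.subset_span ⟨j, rfl⟩
  let τ : Fin n → T := fun j ↦ φ ⟨γ j, hγ j⟩
  suffices h_mem : τ ∈ LinearMap.range (LinearMap.pi γ) by
    obtain ⟨t, ht⟩ := h_mem
    refine ⟨LinearMap.toSpanSingleton _ T t, fun x hx ↦ ?_⟩
    obtain ⟨c, rfl⟩ := (Submodule.mem_span_range_iff_exists_fun _).mp hx
    have hx' : (⟨_, hx⟩ : Submodule.span (Module.End A T) (Set.range γ)) =
        ∑ j, c j • ⟨γ j, hγ j⟩ := Subtype.ext (by simp)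
    rw [hx', map_sum, map_sum]
    refine Finset.sum_congr rfl fun j _ ↦ ?_
    rw [map_smul, map_smul]
    exact congrArg (c j • ·) (congrFun ht j)
  obtain ⟨k, f, hf⟩ := hcog ((Fin n → T) ⧸ LinearMap.range (LinearMap.pi γ)) inferInstance
  rw [← Submodule.Quotient.mk_eq_zero, ← hf.eq_iff, map_zero]
  ext l
  let c : Fin n → Module.End A T := fun j ↦
    LinearMap.proj l ∘ₗ f ∘ₗ Submodule.mkQ _ ∘ₗ LinearMap.single A (fun _ ↦ T) j
  have hc (v : Fin n → T) : f (Submodule.Quotient.mk v) l = ∑ j, c j (v j) := by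
    conv_lhs => rw [← Finset.univ_sum_single v]
    rw [← Submodule.mkQ_apply, map_sum, map_sum, Finset.sum_apply]
    rfl
  have h_rel : ∑ j, c j • (⟨γ j, hγ j⟩ : Submodule.span (Module.End A T) (Set.range γ)) = 0 := by
    refine Subtype.ext (LinearMap.ext fun t ↦ ?_)
    have h0 : Submodule.Quotient.mk (p := LinearMap.range (LinearMap.pi γ)) (fun j ↦ γ j t) = 0 :=
      (Submodule.Quotient.mk_eq_zero _).mpr ⟨t, rfl⟩
    have := hc fun j ↦ γ j t
    rw [h0, map_zero] at this
    simpa using this.symm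
  have := congrArg φ h_rel
  simp only [map_sum, map_smul, map_zero] at this
  exact (hc τ).trans this

/-- A finitely presented module `T` yields an exact sequence `0 → End T → T ^ n → T ^ m` of
modules over its endomorphism ring. -/
theorem exists_exact_end_pi [IsNoetherianRing A] [Module.Finite A T] :
    ∃ (n m : ℕ) (g : Module.End A T →ₗ[Module.End A T] (Fin n → T))
      (f : (Fin n → T) →ₗ[Module.End A T] (Fin m → T)),
      Function.Injective g ∧ Function.Exact g f := by
  obtain ⟨n, q, hq⟩ := Module.Finite.exists_fin' A T
  obtain ⟨m, κ, hκ⟩ := Submodule.fg_iff_exists_fin_generating_family.mp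
    (IsNoetherian.noetherian (LinearMap.ker q))
  let g : Module.End A T →ₗ[Module.End A T] (Fin n → T) :=
    LinearMap.pi fun j ↦ LinearMap.toSpanSingleton _ T (q (Pi.single j 1))
  let f : (Fin n → T) →ₗ[Module.End A T] (Fin m → T) :=
    { toFun := fun x l ↦ ∑ j, κ l j • x j
      map_add' := fun x y ↦ by ext; simp [Finset.sum_add_distrib]
      map_smul' := fun c x ↦ by ext; simp }
  have hg (γ : Module.End A T) (v : Fin n → A) : γ (q v) = ∑ j, v j • g γ j := by
    conv_lhs => rw [pi_eq_sum_univ' v]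
    simp [g, Pi.single]
  refine ⟨n, m, g, f, fun γ γ' h ↦ ?_, fun x ↦ ⟨fun hx ↦ ?_, ?_⟩⟩
  · ext t
    obtain ⟨v, rfl⟩ := hq t
    rw [hg, hg, h]
  · let r : (Fin n → A) →ₗ[A] T := Fintype.linearCombination A x
    have hr : LinearMap.ker q ≤ LinearMap.ker r := by
      rw [← hκ, Submodule.span_le]
      rintro _ ⟨l, rfl⟩
      exact congrFun hx l
    refine ⟨(LinearMap.ker q).liftQ r hr ∘ₗ (q.quotKerEquivOfSurjective hq).symm.toLinearMap, ?_⟩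
    ext j
    have hj : (q.quotKerEquivOfSurjective hq).symm (q (Pi.single j 1)) =
        Submodule.Quotient.mk (Pi.single j 1) := (LinearEquiv.symm_apply_eq _).mpr rfl
    change (LinearMap.ker q).liftQ r hr
      ((q.quotKerEquivOfSurjective hq).symm (q (Pi.single j 1))) = x j
    rw [hj]
    simp [r, Fintype.linearCombination_apply]
  · rintro ⟨γ, rfl⟩
    ext l
    have hl : κ l ∈ LinearMap.ker q := hκ ▸ Submodule.subset_span ⟨l, rfl⟩
    exact (hg γ (κ l)).symm.trans (by rw [LinearMap.mem_ker.mp hl, map_zero]; rfl)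

/-- The endomorphism ring of a finite module over an Artin algebra is left Noetherian. -/
theorem isNoetherianRing_end_of_finite_algebra (R : Type*) [CommRing R] [IsNoetherianRing R]
    [Algebra R A] [Module.Finite R A] [Module.Finite A T] :
    IsNoetherianRing (Module.End A T) := by
  let : Module R T := Module.compHom T (algebraMap R A)
  have : IsScalarTower R A T := .of_algebraMap_smul fun _ _ ↦ rfl
  have : SMulCommClass A R T := IsScalarTower.to_smulCommClass'
  have : Module.Finite R T := .trans A T
  have : IsNoetherian R (Module.End A T) :=
    isNoetherian_of_injective (LinearMap.restrictScalarsₗ R A T T R)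
      (LinearMap.restrictScalars_injective R)
  exact isNoetherian_of_tower R ‹_›

end End

/-- If `T` is a generator-cogenerator over the Artin algebra `A` and
`Γ = End_A(T)`, then `T` is a projective-injective `Γ`-module, `Γ` has dominant dimension
at least `2` (witnessed by an exact sequence `0 → Γ → T_0 → T_1` with `T_0, T_1 ∈ add T`),
and a finitely generated `Γ`-module is projective-injective iff it lies in `add T`. -/
theorem stmt3 (R : Type u) [CommRing R] [IsArtinianRing R]
    (A : Type u) [Ring A] [Algebra R A] [Module.Finite R A]
    (T : Type u) [AddCommGroup T] [Module A T] [Module.Finite A T]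
    (hgen : InAdd A T A) (hcog : IsCogenerator A T) :
    Module.Projective (Module.End A T) T ∧ Module.Injective (Module.End A T) T ∧
    IDomdimGE (Module.End A T) T (Module.End A T) 2 ∧
    (∀ (X : Type u) [AddCommGroup X] [Module (Module.End A T) X],
      Module.Finite (Module.End A T) X →
      ((Module.Projective (Module.End A T) X ∧ Module.Injective (Module.End A T) X) ↔
        InAdd (Module.End A T) T X)) := by
  have : IsNoetherianRing A := .of_finite R A
  have : IsNoetherianRing (Module.End A T) := isNoetherianRing_end_of_finite_algebra R
  have hproj : Module.Projective (Module.End A T) T := projective_end_of_inAdd hgen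
  have hinj : Module.Injective (Module.End A T) T := injective_end_of_isCogenerator hcog
  obtain ⟨n, m, g, f, hg, hgf⟩ := exists_exact_end_pi (A := A) (T := T)
  refine ⟨hproj, hinj, ?_, fun X _ _ _ ↦ ⟨fun ⟨_, _⟩ ↦ ?_, fun h ↦ ⟨h.projective, .of_inAdd h⟩⟩⟩
  · exact ⟨fun i ↦ .of _ (Fin (if i = 0 then n else m) → T), g,
      fun | 0 => f | _ + 1 => 0, fun _ _ ↦ .pi _, fun _ ↦ hg, fun _ ↦ hgf, by omega⟩
  · obtain ⟨k, _, s, _, hs, _⟩ :=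
      Module.Finite.exists_comp_eq_id_of_projective (Module.End A T) X
    let e := (LinearEquiv.curry (Module.End A T) T (Fin k) (Fin n)).symm
    exact .of_injective (e.toLinearMap ∘ₗ g.compLeft (Fin k) ∘ₗ s)
      (e.injective.comp (hg.comp_left.comp hs))
end

section
/- Let A be an Artin algebra, M a finitely generated A-module satisfying (i) M is a cogenerator over A, (ii) Ext^i_A(M,M) = 0 for 1 ≤ i ≤ n−1 for some n ≥ 1, and (iii) M-codim A ≤ m for some m ≥ 0, and let Λ = End_A(M) and I = M viewed as a left Λ-module. Then the contravariant functor Hom_A(−,M) from finitely generated A-modules to finitely generated Λ-modules is fully faithful, and its essential image consists exactly of those finitely generated Λ-modules Y for which there exists an exact sequence 0 → Y → I_0 → I_1 of Λ-modules with I_0, I_1 ∈ add I (i.e., the Λ-modules Y with I-domdim Y ≥ 2). -/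
open CategoryTheory

universe u

/-- Precomposition with `h : X →ₗ[A] Z` as a `Λ`-linear map
`Hom_A(Z,M) → Hom_A(X,M)`, where `Λ = End_A(M)` acts on homs by postcomposition. -/
def precompHom (A : Type u) [Ring A] (M : Type u) [AddCommGroup M] [Module A M]
    {X Z : Type u} [AddCommGroup X] [Module A X] [AddCommGroup Z] [Module A Z]
    (h : X →ₗ[A] Z) : (Z →ₗ[A] M) →ₗ[Module.End A M] (X →ₗ[A] M) where
  toFun φ := φ ∘ₗ h
  map_add' φ ψ := by ext x; simp
  map_smul' c φ := rfl

section CogeneratorDuality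

variable {A : Type u} [Ring A] {M : Type u} [AddCommGroup M] [Module A M]

/-- Over a cogenerator, maps to `M` separate the points of a finitely generated module. -/
lemma IsCogenerator.eq_of_forall_hom_eq (hcog : IsCogenerator A M) {Z : Type u} [AddCommGroup Z]
    [Module A Z] [Module.Finite A Z] {z z' : Z} (h : ∀ f : Z →ₗ[A] M, f z = f z') : z = z' := by
  obtain ⟨k, j, hj⟩ := hcog Z inferInstance
  exact hj (funext fun i => h (LinearMap.proj i ∘ₗ j))

/-- An `End_A(M)`-linear map `Hom_A(Z, M) → M` agrees on any finite family with the evaluation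
at some element of `Z`. -/
lemma IsCogenerator.exists_forall_apply_eq [Module.Finite A M] (hcog : IsCogenerator A M)
    {Z : Type u} [AddCommGroup Z] [Module A Z] (ψ : (Z →ₗ[A] M) →ₗ[Module.End A M] M)
    {k : ℕ} (f : Fin k → (Z →ₗ[A] M)) : ∃ z : Z, ∀ i, f i z = ψ (f i) := by
  let F : Z →ₗ[A] (Fin k → M) := LinearMap.pi f
  suffices h : (F.range.mkQ fun i => ψ (f i)) = 0 by
    rw [Submodule.mkQ_apply, Submodule.Quotient.mk_eq_zero] at h
    obtain ⟨z, hz⟩ := h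
    exact ⟨z, fun i => congrFun hz i⟩
  refine hcog.eq_of_forall_hom_eq fun q => ?_
  let c : Fin k → Module.End A M := fun i =>
    q ∘ₗ F.range.mkQ ∘ₗ LinearMap.single A (fun _ : Fin k => M) i
  have hc (v : Fin k → M) : q (F.range.mkQ v) = ∑ i, c i (v i) := by
    conv_lhs => rw [← Finset.univ_sum_single v]
    simp only [map_sum]
    rfl
  have hzero : ∑ i, c i • f i = 0 := by
    ext z
    have hz : F.range.mkQ (F z) = 0 := by simp
    have := hc (F z)
    rw [hz, map_zero] at this
    simpa [F] using this.symm
  rw [hc, map_zero]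
  simpa using congrArg ψ hzero

/-- Every finitely generated module is `M`-reflexive when `M` is a cogenerator. -/
lemma IsCogenerator.exists_eval_eq [Module.Finite A M] (hcog : IsCogenerator A M)
    {Z : Type u} [AddCommGroup Z] [Module A Z] [Module.Finite A Z]
    (ψ : (Z →ₗ[A] M) →ₗ[Module.End A M] M) : ∃ z : Z, ∀ f, f z = ψ f := by
  obtain ⟨k, j, hj⟩ := hcog Z inferInstance
  obtain ⟨z, hz⟩ := hcog.exists_forall_apply_eq ψ fun i => LinearMap.proj i ∘ₗ j
  refine ⟨z, fun f => ?_⟩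
  obtain ⟨z', hz'⟩ := hcog.exists_forall_apply_eq ψ
    (Fin.cons f fun i => LinearMap.proj i ∘ₗ j : Fin (k + 1) → (Z →ₗ[A] M))
  have hzz : z = z' := hj (funext fun i => (hz i).trans (hz' i.succ).symm)
  rw [hzz]
  exact hz' 0

/-- The double centralizer property: every `End_A(M)`-endomorphism of a finitely generated
cogenerator `M` is multiplication by a scalar. -/
lemma IsCogenerator.exists_smul_eq [Module.Finite A M] (hcog : IsCogenerator A M)
    (ψ : M →ₗ[Module.End A M] M) : ∃ a : A, ∀ x, ψ x = a • x := by
  let ev : (A →ₗ[A] M) →ₗ[Module.End A M] M :=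
    { toFun := fun f => f 1
      map_add' := fun _ _ => rfl
      map_smul' := fun _ _ => rfl }
  obtain ⟨a, ha⟩ := hcog.exists_eval_eq (ψ ∘ₗ ev)
  refine ⟨a, fun x => ?_⟩
  simpa [ev] using (ha (LinearMap.toSpanSingleton A M x)).symm

/-- `Hom_A(-, M)` is fully faithful on finitely generated modules. -/
lemma IsCogenerator.precompHom_bijective [Module.Finite A M] (hcog : IsCogenerator A M)
    (X Z : Type u) [AddCommGroup X] [Module A X] [AddCommGroup Z] [Module A Z]
    [Module.Finite A Z] : Function.Bijective (fun h : X →ₗ[A] Z => precompHom A M h) := by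
  constructor
  · intro h h' hh
    ext x
    exact hcog.eq_of_forall_hom_eq fun f => LinearMap.congr_fun (LinearMap.congr_fun hh f) x
  · intro Φ
    let ev (x : X) : (X →ₗ[A] M) →ₗ[Module.End A M] M :=
      { toFun := fun f => f x
        map_add' := fun _ _ => rfl
        map_smul' := fun _ _ => rfl }
    choose h hh using fun x => hcog.exists_eval_eq (ev x ∘ₗ Φ)
    have hh' (x : X) (f : Z →ₗ[A] M) : f (h x) = Φ f x := hh x f
    refine ⟨
      { toFun := h
        map_add' := fun x y => hcog.eq_of_forall_hom_eq fun f => by simp [hh']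
        map_smul' := fun a x => hcog.eq_of_forall_hom_eq fun f => by simp [hh'] }, ?_⟩
    ext f x
    exact hh' x f

/-- The action of a matrix over `A` on powers of `M`, as an `End_A(M)`-linear map. -/
def matrixAction (M : Type u) [AddCommGroup M] [Module A M] {ι κ : Type*} [Fintype ι]
    (r : κ → ι → A) : (ι → M) →ₗ[Module.End A M] (κ → M) where
  toFun v j := ∑ i, r j i • v i
  map_add' v w := by ext j; simp [Finset.sum_add_distrib]
  map_smul' c v := by ext j; simp [map_sum]

/-- Evaluation on a family of generators identifies `Hom_A(X, M)` with the kernel of the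
matrix of relations. -/
lemma exact_eval_matrixAction {X : Type u} [AddCommGroup X] [Module A X]
    {ι κ : Type*} [Fintype ι] [DecidableEq ι] (p : (ι → A) →ₗ[A] X)
    (hp : Function.Surjective p) (r : κ → ι → A) (hr : Submodule.span A (Set.range r) = p.ker) :
    ∃ g : (X →ₗ[A] M) →ₗ[Module.End A M] (ι → M),
      Function.Injective g ∧ Function.Exact g (matrixAction M r) := by
  let g : (X →ₗ[A] M) →ₗ[Module.End A M] (ι → M) :=
    { toFun := fun f i => f (p (Pi.single i 1))
      map_add' := fun _ _ => rfl
      map_smul' := fun _ _ => rfl }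
  have hg (f : X →ₗ[A] M) (i : ι) : g f i = f (p (Pi.single i 1)) := rfl
  have hmem (j : κ) : p (r j) = 0 := by
    rw [← LinearMap.mem_ker, ← hr]
    exact Submodule.subset_span ⟨j, rfl⟩
  have hsum (f : X →ₗ[A] M) (v : ι → A) : ∑ i, v i • g f i = f (p v) := by
    conv_rhs => rw [pi_eq_sum_univ' v]
    simp [hg, map_sum]
  refine ⟨g, fun f f' hff => ?_, fun v => ⟨fun hv => ?_, ?_⟩⟩
  · ext x
    obtain ⟨v, rfl⟩ := hp x
    rw [← hsum, ← hsum, hff]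
  · let q : (ι → A) →ₗ[A] M := Fintype.linearCombination A v
    have hq : p.ker ≤ q.ker := by
      rw [← hr, Submodule.span_le]
      rintro _ ⟨j, rfl⟩
      exact congrFun hv j
    refine ⟨p.ker.liftQ q hq ∘ₗ (p.quotKerEquivOfSurjective hp).symm.toLinearMap, ?_⟩
    ext i
    have : (p.quotKerEquivOfSurjective hp).symm (p (Pi.single i 1)) =
        p.ker.mkQ (Pi.single i 1) := by
      rw [LinearEquiv.symm_apply_eq]
      rfl
    rw [hg, LinearMap.comp_apply, LinearEquiv.coe_coe, this]
    simp [q, Fintype.linearCombination_apply, Pi.single_apply]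
  · rintro ⟨f, rfl⟩
    ext j
    change ∑ i, r j i • g f i = 0
    rw [hsum, hmem, map_zero]

lemma inAdd_pi (Λ : Type u) [Ring Λ] (I : Type u) [AddCommGroup I] [Module Λ I] (k : ℕ) :
    InAdd Λ I (Fin k → I) :=
  ⟨k, LinearMap.id, LinearMap.id, rfl⟩

lemma iDomdimGE_two_iff (Λ : Type u) [Ring Λ] (I : Type u) [AddCommGroup I] [Module Λ I]
    (Y : Type u) [AddCommGroup Y] [Module Λ Y] :
    IDomdimGE Λ I Y 2 ↔ ∃ (a b : ℕ) (g : Y →ₗ[Λ] (Fin a → I))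
      (f : (Fin a → I) →ₗ[Λ] (Fin b → I)), Function.Injective g ∧ Function.Exact g f := by
  constructor
  · rintro ⟨J, g, f, hJ, hg, hgf, -⟩
    obtain ⟨a, ι₀, π₀, h₀⟩ := hJ 0 (by norm_num)
    obtain ⟨b, ι₁, π₁, h₁⟩ := hJ 1 (by norm_num)
    have h₀' (x) : π₀ (ι₀ x) = x := LinearMap.congr_fun h₀ x
    have h₁' (x) : π₁ (ι₁ x) = x := LinearMap.congr_fun h₁ x
    have hι₀ : Function.Injective ι₀ := Function.LeftInverse.injective h₀'
    have hι₁ : Function.Injective ι₁ := Function.LeftInverse.injective h₁'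
    let e : (Fin a → I) →ₗ[Λ] (Fin a → I) := LinearMap.id - ι₀ ∘ₗ π₀
    let φ : (Fin a → I) →ₗ[Λ] (Fin (b + a) → I) :=
      LinearMap.funLeft Λ I finSumFinEquiv.symm ∘ₗ
        (LinearEquiv.sumArrowLequivProdArrow (Fin b) (Fin a) Λ I).symm.toLinearMap ∘ₗ
        (ι₁ ∘ₗ f 0 ∘ₗ π₀).prod e
    have hφ (v : Fin a → I) : φ v = 0 ↔ f 0 (π₀ v) = 0 ∧ v = ι₀ (π₀ v) := by
      have hinj : Function.Injective
          (LinearMap.funLeft Λ I (finSumFinEquiv (m := b) (n := a)).symm) :=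
        LinearMap.funLeft_injective_of_surjective _ _ _ (Equiv.surjective _)
      rw [LinearMap.comp_apply, map_eq_zero_iff _ hinj, LinearMap.comp_apply, LinearEquiv.coe_coe,
        LinearEquiv.map_eq_zero_iff, Prod.ext_iff]
      refine and_congr ?_ ?_
      · exact map_eq_zero_iff ι₁ hι₁
      · exact sub_eq_zero
    refine ⟨a, b + a, ι₀ ∘ₗ g, φ, hι₀.comp (hg (by norm_num)), fun v => ?_⟩
    rw [hφ]
    constructor
    · rintro ⟨hv, hv'⟩
      obtain ⟨y, hy⟩ := (hgf le_rfl _).1 hv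
      exact ⟨y, by rw [LinearMap.comp_apply, hy, ← hv']⟩
    · rintro ⟨y, rfl⟩
      simp only [LinearMap.comp_apply, h₀']
      exact ⟨(hgf le_rfl _).2 ⟨y, rfl⟩, trivial⟩
  · rintro ⟨a, b, g, f, hg, hgf⟩
    let J : ℕ → ModuleCat.{u} Λ
      | 0 => ModuleCat.of Λ (Fin a → I)
      | _ + 1 => ModuleCat.of Λ (Fin b → I)
    let F : ∀ i, (J i : Type u) →ₗ[Λ] J (i + 1)
      | 0 => f
      | _ + 1 => 0
    refine ⟨J, g, F, fun i _ => ?_, fun _ => hg, fun _ => hgf, fun i hi => by omega⟩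
    cases i with
    | zero => exact inAdd_pi Λ I a
    | succ i => exact inAdd_pi Λ I b

/-- Over a finitely generated cogenerator, every `End_A(M)`-linear map between powers of `M` is
given by a matrix over `A`. -/
lemma IsCogenerator.exists_matrixAction_eq [Module.Finite A M] (hcog : IsCogenerator A M)
    {ι κ : Type*} [Fintype ι] [DecidableEq ι] (f : (ι → M) →ₗ[Module.End A M] (κ → M)) :
    ∃ r : κ → ι → A, f = matrixAction M r := by
  choose r hr using fun j i => hcog.exists_smul_eq
    (LinearMap.proj j ∘ₗ f ∘ₗ LinearMap.single (Module.End A M) (fun _ : ι => M) i)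
  refine ⟨r, ?_⟩
  ext i x j
  have := hr j i x
  simp only [LinearMap.comp_apply, LinearMap.proj_apply] at this
  simp only [LinearMap.comp_apply]
  rw [this]
  change _ = ∑ i', r j i' • (Pi.single i x : ι → M) i'
  rw [Finset.sum_eq_single i] <;> simp +contextual

end CogeneratorDuality

/-- Under the hypotheses of Theorem 3.3, the contravariant functor
`Hom_A(-,M)` is fully faithful (on finitely generated modules) and its essential image
consists exactly of the finitely generated `Λ`-modules `Y` with `I`-domdim `Y ≥ 2`,
where `Λ = End_A(M)` and `I = M` as a `Λ`-module. -/
theorem stmt4 (R : Type u) [CommRing R] [IsArtinianRing R]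
    (A : Type u) [Ring A] [Algebra R A] [Module.Finite R A]
    (M : Type u) [AddCommGroup M] [Module A M] [Module.Finite A M]
    (n m : ℕ) (hn : 1 ≤ n)
    (hcog : IsCogenerator A M)
    (hext : ∀ i : ℕ, 1 ≤ i → i ≤ n - 1 → ExtVanishes A M M i)
    (hcodim : MCodimLE A M m) :
    (∀ (X Z : Type u) [AddCommGroup X] [Module A X] [AddCommGroup Z] [Module A Z],
      Module.Finite A X → Module.Finite A Z →
      Function.Bijective (fun h : X →ₗ[A] Z => precompHom A M h)) ∧
    (∀ (Y : Type u) [AddCommGroup Y] [Module (Module.End A M) Y],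
      Module.Finite (Module.End A M) Y →
      ((∃ X : ModuleCat.{u} A, Module.Finite A X ∧
          Nonempty (Y ≃ₗ[Module.End A M] ((X : Type u) →ₗ[A] M))) ↔
        IDomdimGE (Module.End A M) M Y 2)) := by
  have : IsNoetherianRing A :=
    isNoetherian_of_tower R (isNoetherian_of_isNoetherianRing_of_finite R A)
  refine ⟨fun X Z _ _ _ _ _ _ => hcog.precompHom_bijective X Z, fun Y _ _ _ => ?_⟩
  rw [iDomdimGE_two_iff]
  constructor
  · rintro ⟨X, hX, ⟨e⟩⟩
    obtain ⟨a, p, hp⟩ := Module.Finite.exists_fin' A X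
    obtain ⟨b, r, hr⟩ := Submodule.fg_iff_exists_fin_generating_family.1
      (IsNoetherian.noetherian p.ker)
    obtain ⟨g, hg, hgr⟩ := exact_eval_matrixAction (M := M) p hp r hr
    refine ⟨a, b, g ∘ₗ e.toLinearMap, matrixAction M r, hg.comp e.injective, fun v => ?_⟩
    rw [hgr v, LinearMap.coe_comp, LinearEquiv.coe_coe, e.surjective.range_comp]
  · rintro ⟨a, b, g, f, hg, hgf⟩
    obtain ⟨r, rfl⟩ := hcog.exists_matrixAction_eq f
    let N : Submodule A (Fin a → A) := Submodule.span A (Set.range r)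
    obtain ⟨g', hg', hgr⟩ := exact_eval_matrixAction (M := M) N.mkQ N.mkQ_surjective r
      N.ker_mkQ.symm
    refine ⟨ModuleCat.of A ((Fin a → A) ⧸ N), inferInstanceAs (Module.Finite A (_ ⧸ N)), ⟨?_⟩⟩
    have hrange : g.range = g'.range := by
      rw [← LinearMap.exact_iff.1 hgf, ← LinearMap.exact_iff.1 hgr]
    exact (LinearEquiv.ofInjective g hg).trans
      ((LinearEquiv.ofEq _ _ hrange).trans (LinearEquiv.ofInjective g' hg').symm)
end

section
/- Let A be an Artin algebra, M a finitely generated A-module satisfying (i) M is a cogenerator over A, (ii) Ext^i_A(M,M) = 0 for 1 ≤ i ≤ n−1 for some n ≥ 1, and (iii) M-codim A ≤ m for some m ≥ 0, and let Λ = End_A(M) and I = M viewed as a left Λ-module. Then for every finitely generated A-module X, I-domdim Hom_A(X,M) = inf{ i ≥ 1 : Ext^i_A(X,M) ≠ 0 } + 1, where both sides are computed in ℕ ∪ {∞}. In particular I-domdim Hom_A(X,M) ≥ 2 for every X. -/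
open CategoryTheory

universe u

/-- The relative dominant dimension `I`-domdim `Y` as an element of `ℕ ∪ {∞}`. -/
noncomputable def IDomdim (Λ : Type u) [Ring Λ] (I : Type u) [AddCommGroup I] [Module Λ I]
    (Y : Type u) [AddCommGroup Y] [Module Λ Y] : ℕ∞ :=
  sSup {e : ℕ∞ | ∃ t : ℕ, e = t ∧ IDomdimGE Λ I Y t}

lemma LinearMap.exists_comp_eq_of_ker_le {B : Type*} [Ring B] {U V W : Type*}
    [AddCommGroup U] [Module B U] [AddCommGroup V] [Module B V] [AddCommGroup W] [Module B W]
    {p : U →ₗ[B] V} (hp : Function.Surjective p) {φ : U →ₗ[B] W}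
    (h : LinearMap.ker p ≤ LinearMap.ker φ) : ∃ ψ : V →ₗ[B] W, ψ ∘ₗ p = φ := by
  refine ⟨(LinearMap.ker p).liftQ φ h ∘ₗ (p.quotKerEquivOfSurjective hp).symm.toLinearMap,
    LinearMap.ext fun x => ?_⟩
  have hx : (p.quotKerEquivOfSurjective hp).symm (p x) = (LinearMap.ker p).mkQ x := by
    rw [LinearEquiv.symm_apply_eq]
    rfl
  simp only [LinearMap.comp_apply, LinearEquiv.coe_coe, hx]
  simp

/-- Dimension shifting along `0 → ker f → P → X → 0` with `P` projective. -/
lemma extVanishes_add_two_iff {A : Type u} [Ring A] {X P M : Type u}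
    [AddCommGroup X] [Module A X] [AddCommGroup P] [Module A P] [AddCommGroup M] [Module A M]
    [Module.Projective A P] (f : P →ₗ[A] X) (hf : Function.Surjective f) (i : ℕ) :
    ExtVanishes A X M (i + 2) ↔ ExtVanishes A (LinearMap.ker f) M (i + 1) := by
  have hS := f.shortExact_shortComplexKer hf
  have : Projective f.shortComplexKer.X₂ :=
    (IsProjective.iff_projective P).mp inferInstance
  constructor
  · intro h
    refine (subsingleton_iff_forall_eq 0).mpr fun y => ?_
    obtain ⟨z, hz⟩ := Abelian.Ext.contravariant_sequence_exact₁ hS (ModuleCat.of A M) y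
      (n₁ := i + 2) (by lia) (h.elim _ _)
    rw [← hz, Abelian.Ext.eq_zero_of_projective z, Abelian.Ext.comp_zero]
  · intro h
    refine (subsingleton_iff_forall_eq 0).mpr fun y => ?_
    obtain ⟨z, hz⟩ := Abelian.Ext.contravariant_sequence_exact₃ hS (ModuleCat.of A M) y
      (Abelian.Ext.eq_zero_of_projective _) (n₀ := i + 1) (by lia)
    rw [← hz, h.elim z 0, Abelian.Ext.comp_zero]

lemma extVanishes_one_iff {A : Type u} [Ring A] {X P M : Type u}
    [AddCommGroup X] [Module A X] [AddCommGroup P] [Module A P] [AddCommGroup M] [Module A M]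
    [Module.Projective A P] (f : P →ₗ[A] X) (hf : Function.Surjective f) :
    ExtVanishes A X M 1 ↔
      ∀ φ : LinearMap.ker f →ₗ[A] M, ∃ ψ : P →ₗ[A] M, ψ ∘ₗ (LinearMap.ker f).subtype = φ := by
  have hS := f.shortExact_shortComplexKer hf
  have : Projective f.shortComplexKer.X₂ :=
    (IsProjective.iff_projective P).mp inferInstance
  constructor
  · intro h φ
    obtain ⟨z, hz⟩ := Abelian.Ext.contravariant_sequence_exact₁ hS (ModuleCat.of A M)
      (Abelian.Ext.mk₀ (ModuleCat.ofHom φ)) (n₁ := 1) (by lia) (h.elim _ _)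
    obtain ⟨ψ, rfl⟩ := Abelian.Ext.homEquiv₀.symm.surjective z
    refine ⟨ψ.hom, ?_⟩
    have h2 : Abelian.Ext.mk₀ (f.shortComplexKer.f ≫ ψ) =
        Abelian.Ext.mk₀ (ModuleCat.ofHom φ) := by
      simpa using hz
    exact congrArg ModuleCat.Hom.hom (Abelian.Ext.homEquiv₀.symm.injective h2)
  · intro h
    refine (subsingleton_iff_forall_eq 0).mpr fun y => ?_
    obtain ⟨z, rfl⟩ := Abelian.Ext.contravariant_sequence_exact₃ hS (ModuleCat.of A M) y
      (Abelian.Ext.eq_zero_of_projective _) (n₀ := 0) (by lia)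
    obtain ⟨φ, rfl⟩ := Abelian.Ext.homEquiv₀.symm.surjective z
    obtain ⟨ψ, hψ⟩ := h φ.hom
    have : φ = f.shortComplexKer.f ≫ ModuleCat.ofHom ψ := by
      ext x
      exact (LinearMap.congr_fun hψ x).symm
    subst this
    change hS.extClass.comp (Abelian.Ext.mk₀ (f.shortComplexKer.f ≫ ModuleCat.ofHom ψ)) _ = 0
    rw [← Abelian.Ext.mk₀_comp_mk₀]
    exact hS.extClass_comp_assoc _

/-- `Ext` groups computed from a projective resolution that is exact in low degrees. -/
lemma extVanishes_iff_exact {A : Type u} [Ring A] {M : Type u} [AddCommGroup M] [Module A M]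
    (i : ℕ) : ∀ {X : Type u} [AddCommGroup X] [Module A X] (P : ℕ → ModuleCat.{u} A)
    (d : ∀ j, (P (j + 1) : Type u) →ₗ[A] P j) (ε : (P 0 : Type u) →ₗ[A] X)
    (_ : ∀ j ≤ i, Module.Projective A (P j)) (_ : Function.Surjective ε)
    (_ : Function.Exact (d 0) ε) (_ : ∀ j ≤ i, Function.Exact (d (j + 1)) (d j)),
    ExtVanishes A X M (i + 1) ↔
      Function.Exact (fun φ : (P i : Type u) →ₗ[A] M => φ ∘ₗ d i)
        (fun φ : (P (i + 1) : Type u) →ₗ[A] M => φ ∘ₗ d (i + 1)) := by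
  induction i with
  | zero =>
    intro X _ _ P d ε hP hε h0 hd
    have := hP 0 le_rfl
    rw [extVanishes_one_iff ε hε]
    have hmem : ∀ x, d 0 x ∈ LinearMap.ker ε := fun x => (h0 _).mpr ⟨x, rfl⟩
    set p : (P 1 : Type u) →ₗ[A] LinearMap.ker ε := (d 0).codRestrict _ hmem
    have hpsurj : Function.Surjective p := by
      rintro ⟨y, hy⟩
      obtain ⟨x, hx⟩ := (h0 y).mp hy
      exact ⟨x, Subtype.ext hx⟩
    constructor
    · intro h φ
      constructor
      · intro hφ
        have hker : LinearMap.ker p ≤ LinearMap.ker φ := by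
          intro x hx
          obtain ⟨y, rfl⟩ := (hd 0 le_rfl x).mp (congrArg Subtype.val hx)
          exact LinearMap.congr_fun hφ y
        obtain ⟨χ, rfl⟩ := LinearMap.exists_comp_eq_of_ker_le hpsurj hker
        obtain ⟨ψ, rfl⟩ := h χ
        exact ⟨ψ, rfl⟩
      · rintro ⟨ψ, rfl⟩
        ext x
        have : d 0 (d 1 x) = 0 := (hd 0 le_rfl _).mpr ⟨x, rfl⟩
        simp [this]
    · intro h φ
      obtain ⟨ψ, hψ⟩ := (h (φ ∘ₗ p)).mp (by
        ext x
        have : p (d 1 x) = 0 := Subtype.ext ((hd 0 le_rfl _).mpr ⟨x, rfl⟩)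
        simp [this])
      refine ⟨ψ, LinearMap.ext fun x => ?_⟩
      obtain ⟨y, rfl⟩ := hpsurj x
      exact LinearMap.congr_fun hψ y
  | succ i ih =>
    intro X _ _ P d ε hP hε h0 hd
    have := hP 0 (Nat.zero_le _)
    rw [extVanishes_add_two_iff ε hε]
    have hmem : ∀ x, d 0 x ∈ LinearMap.ker ε := fun x => (h0 _).mpr ⟨x, rfl⟩
    refine ih (fun j => P (j + 1)) (fun j => d (j + 1)) ((d 0).codRestrict _ hmem)
      (fun j hj => hP _ (by lia)) ?_ ?_ (fun j hj => hd _ (by lia))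
    · rintro ⟨y, hy⟩
      obtain ⟨x, hx⟩ := (h0 y).mp hy
      exact ⟨x, Subtype.ext hx⟩
    · intro x
      rw [← hd 0 (Nat.zero_le _) x]
      exact Subtype.ext_iff

section Bidual

variable {A : Type u} [Ring A] {M : Type u} [AddCommGroup M] [Module A M]

/-- Every `Λ`-linear functional with values in `M` on a finitely generated `Λ`-submodule of
`Hom_A(X, M)` is evaluation at some `x : X`. -/
lemma IsCogenerator.exists_forall_eq_apply [Module.Finite A M] (hcog : IsCogenerator A M)
    {X : Type u} [AddCommGroup X] [Module A X] (N : Submodule (Module.End A M) (X →ₗ[A] M))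
    [Module.Finite (Module.End A M) N] (ψ : N →ₗ[Module.End A M] M) :
    ∃ x : X, ∀ f : N, ψ f = f.1 x := by
  obtain ⟨r, s, hs⟩ := Module.Finite.exists_fin (R := Module.End A M) (M := N)
  let F : X →ₗ[A] (Fin r → M) := LinearMap.pi fun j => (s j).1
  have hmem : (fun j => ψ (s j)) ∈ LinearMap.range F := by
    by_contra hne
    obtain ⟨k, e, he⟩ := hcog ((Fin r → M) ⧸ LinearMap.range F) inferInstance
    have h0 : e ((LinearMap.range F).mkQ fun j => ψ (s j)) ≠ 0 := by
      rw [Ne, map_eq_zero_iff e he]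
      simpa using hne
    obtain ⟨c, hc⟩ := Function.ne_iff.mp h0
    let h : (Fin r → M) →ₗ[A] M := LinearMap.proj c ∘ₗ e ∘ₗ (LinearMap.range F).mkQ
    have hsum : ∀ v : Fin r → M,
        h v = ∑ j, (h ∘ₗ LinearMap.single A (fun _ => M) j : Module.End A M) • v j := by
      intro v
      conv_lhs => rw [← Finset.univ_sum_single v]
      rw [map_sum]
      rfl
    have hzero : ∑ j, (h ∘ₗ LinearMap.single A (fun _ => M) j : Module.End A M) • s j = 0 := by
      ext x
      have hx := hsum (F x)
      have hF : h (F x) = 0 := by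
        have : (LinearMap.range F).mkQ (F x) = 0 := by simp
        simp only [h, LinearMap.comp_apply, this, map_zero]
      rw [hF] at hx
      simpa [F] using hx.symm
    apply hc
    change h (fun j => ψ (s j)) = 0
    rw [hsum]
    simp_rw [← map_smul, ← map_sum]
    rw [hzero, map_zero]
  obtain ⟨x, hx⟩ := hmem
  refine ⟨x, fun f => ?_⟩
  have hf : f ∈ Submodule.span (Module.End A M) (Set.range s) := hs ▸ Submodule.mem_top
  induction hf using Submodule.span_induction with
  | mem f hf =>
    obtain ⟨j, rfl⟩ := hf
    exact (congrFun hx j).symm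
  | zero => simp
  | add f g _ _ hf hg => simp [hf, hg]
  | smul a f _ hf => simp [hf]

lemma isNoetherian_end_hom (R : Type u) [CommRing R] [IsArtinianRing R] [Algebra R A]
    [Module.Finite R A] [Module.Finite A M] (X : Type u) [AddCommGroup X] [Module A X]
    [Module.Finite A X] : IsNoetherian (Module.End A M) (X →ₗ[A] M) := by
  let : Module R M := Module.compHom M (algebraMap R A)
  have : IsScalarTower R A M := ⟨fun r a x => by
    rw [Algebra.smul_def, mul_smul]; rfl⟩
  have : Module.Finite R M := Module.Finite.trans A M
  obtain ⟨k, p, hp⟩ := Module.Finite.exists_fin' A X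
  let ev : (X →ₗ[A] M) →ₗ[R] (Fin k → M) :=
    { toFun := fun f j => f (p (Pi.single j 1))
      map_add' := fun _ _ => rfl
      map_smul' := fun _ _ => rfl }
  have hev : Function.Injective ev := by
    intro f g hfg
    have : f ∘ₗ p = g ∘ₗ p := by
      ext j
      simpa [ev] using congrFun hfg j
    ext x
    obtain ⟨y, rfl⟩ := hp x
    exact LinearMap.congr_fun this y
  have : IsNoetherian R (X →ₗ[A] M) := isNoetherian_of_injective ev hev
  exact isNoetherian_of_tower R this

lemma IsCogenerator.baer_end [Module.Finite A M] (hcog : IsCogenerator A M)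
    [IsNoetherian (Module.End A M) (Module.End A M)] :
    Module.Baer (Module.End A M) M := by
  intro L ψ
  obtain ⟨x, hx⟩ := hcog.exists_forall_eq_apply (X := M) L ψ
  exact ⟨LinearMap.toSpanSingleton _ _ x, fun f hf => (hx ⟨f, hf⟩).symm⟩

/-- Evaluation `X → Hom_Λ(Hom_A(X, M), M)`. -/
def homEval (A M : Type u) [Ring A] [AddCommGroup M] [Module A M]
    (X : Type u) [AddCommGroup X] [Module A X] :
    X →ₗ[A] ((X →ₗ[A] M) →ₗ[Module.End A M] M) where
  toFun x :=
    { toFun := fun f => f x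
      map_add' := fun _ _ => rfl
      map_smul' := fun _ _ => rfl }
  map_add' x y := by ext f; exact map_add f x y
  map_smul' a x := by ext f; exact map_smul f a x

lemma IsCogenerator.homEval_bijective [Module.Finite A M] (hcog : IsCogenerator A M)
    (X : Type u) [AddCommGroup X] [Module A X] [Module.Finite A X]
    [IsNoetherian (Module.End A M) (X →ₗ[A] M)] : Function.Bijective (homEval A M X) := by
  constructor
  · rw [injective_iff_map_eq_zero]
    intro x hx
    obtain ⟨k, e, he⟩ := hcog X inferInstance
    rw [← map_eq_zero_iff e he]
    ext c
    exact LinearMap.congr_fun hx (LinearMap.proj c ∘ₗ e)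
  · intro ψ
    obtain ⟨x, hx⟩ := hcog.exists_forall_eq_apply ⊤ (ψ ∘ₗ Submodule.subtype ⊤)
    exact ⟨x, LinearMap.ext fun f => (hx ⟨f, trivial⟩).symm⟩

/-- The `Λ`-linear map `M → Hom_A(A, M)` sending `x` to `a ↦ a • x`. -/
def spanSingletonEnd (A M : Type u) [Ring A] [AddCommGroup M] [Module A M] :
    M →ₗ[Module.End A M] (A →ₗ[A] M) where
  toFun x := LinearMap.toSpanSingleton A M x
  map_add' x y := by ext; simp
  map_smul' φ x := by ext; simp

/-- The action of `A` on `M` by `Λ`-linear endomorphisms. -/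
def actionMap (A M : Type u) [Ring A] [AddCommGroup M] [Module A M] :
    A →ₗ[A] (M →ₗ[Module.End A M] M) where
  toFun a :=
    { toFun := fun x => a • x
      map_add' := fun x y => smul_add a x y
      map_smul' := fun φ x => (φ.map_smul a x).symm }
  map_add' a b := by ext x; exact add_smul a b x
  map_smul' a b := by ext x; exact mul_smul a b x

lemma IsCogenerator.actionMap_bijective [Module.Finite A M] (hcog : IsCogenerator A M)
    [IsNoetherian (Module.End A M) (A →ₗ[A] M)] : Function.Bijective (actionMap A M) := by
  have hb := hcog.homEval_bijective A
  constructor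
  · intro a b hab
    apply hb.1
    ext f
    have := LinearMap.congr_fun hab (f 1)
    change a • f 1 = b • f 1 at this
    change f a = f b
    rwa [← map_smul, ← map_smul, smul_eq_mul, smul_eq_mul, mul_one, mul_one] at this
  · intro φ
    let w : (A →ₗ[A] M) →ₗ[Module.End A M] M :=
      { toFun := fun f => f 1
        map_add' := fun _ _ => rfl
        map_smul' := fun _ _ => rfl }
    obtain ⟨a, ha⟩ := hb.2 (φ ∘ₗ w)
    refine ⟨a, LinearMap.ext fun x => ?_⟩
    have := LinearMap.congr_fun ha (spanSingletonEnd A M x)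
    change a • x = (φ ∘ₗ w) (spanSingletonEnd A M x) at this
    change a • x = φ x
    rw [this]
    simp [w, spanSingletonEnd]

variable {J : Type u} [AddCommGroup J] [Module (Module.End A M) J]

lemma InAdd.projective_hom_s5 (hact : Function.Bijective (actionMap A M))
    (hJ : InAdd (Module.End A M) M J) :
    Module.Projective A (J →ₗ[Module.End A M] M) := by
  obtain ⟨k, ι, π, h⟩ := hJ
  let e := LinearEquiv.ofBijective _ hact
  let s : (J →ₗ[Module.End A M] M) →ₗ[A] (Fin k → A) :=
    LinearMap.pi fun c => e.symm.toLinearMap ∘ₗ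
      LinearMap.lcomp A M (π ∘ₗ LinearMap.single (Module.End A M) (fun _ => M) c)
  let q : (Fin k → A) →ₗ[A] (J →ₗ[Module.End A M] M) :=
    ∑ c, LinearMap.lcomp A M (LinearMap.proj c ∘ₗ ι) ∘ₗ e.toLinearMap ∘ₗ LinearMap.proj c
  refine Module.Projective.of_split s q ?_
  ext φ j
  have h1 : π (ι j) = j := LinearMap.congr_fun h j
  conv_rhs => rw [LinearMap.id_apply, ← h1, ← Finset.univ_sum_single (ι j), map_sum, map_sum]
  simp [q, s]

lemma InAdd.homEval_bijective (hact : Function.Bijective (actionMap A M))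
    (hJ : InAdd (Module.End A M) M J) :
    Function.Bijective fun j : J =>
      ({ toFun := fun φ => φ j
         map_add' := fun _ _ => rfl
         map_smul' := fun _ _ => rfl } : (J →ₗ[Module.End A M] M) →ₗ[A] M) := by
  obtain ⟨k, ι, π, h⟩ := hJ
  have h1 : ∀ j, π (ι j) = j := LinearMap.congr_fun h
  constructor
  · intro j j' hj
    rw [← h1 j, ← h1 j']
    congr 1
    ext c
    exact LinearMap.congr_fun hj (LinearMap.proj c ∘ₗ ι)
  · intro α
    refine ⟨π fun c => α (LinearMap.proj c ∘ₗ ι), LinearMap.ext fun φ => ?_⟩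
    choose a ha using fun c =>
      hact.2 (φ ∘ₗ π ∘ₗ LinearMap.single (Module.End A M) (fun _ => M) c)
    have ha' : ∀ c x, φ (π (Pi.single c x)) = a c • x := fun c x =>
      (LinearMap.congr_fun (ha c) x).symm
    have hφ : φ = ∑ c, a c • (LinearMap.proj c ∘ₗ ι) := by
      ext j
      conv_lhs => rw [← h1 j, ← Finset.univ_sum_single (ι j), map_sum, map_sum]
      simp [ha']
    change φ (π fun c => α (LinearMap.proj c ∘ₗ ι)) = α φ
    rw [← Finset.univ_sum_single (fun c => α (LinearMap.proj c ∘ₗ ι)), map_sum, map_sum]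
    simp only [ha']
    conv_rhs => rw [hφ, map_sum]
    simp

end Bidual

lemma Module.Baer.exact_comp {B : Type u} [Ring B] {Q : Type u} [AddCommGroup Q] [Module B Q]
    (hQ : Module.Baer B Q) {U V W : Type u} [AddCommGroup U] [Module B U] [AddCommGroup V]
    [Module B V] [AddCommGroup W] [Module B W] {a : U →ₗ[B] V} {b : V →ₗ[B] W}
    (h : Function.Exact a b) :
    Function.Exact (fun φ : W →ₗ[B] Q => φ ∘ₗ b) (fun φ : V →ₗ[B] Q => φ ∘ₗ a) := by
  intro φ
  constructor
  · intro hφ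
    have hker : LinearMap.ker b.rangeRestrict ≤ LinearMap.ker φ := by
      intro x hx
      obtain ⟨y, rfl⟩ := (h x).mp (congrArg Subtype.val hx)
      exact LinearMap.congr_fun hφ y
    obtain ⟨χ, rfl⟩ := LinearMap.exists_comp_eq_of_ker_le b.surjective_rangeRestrict hker
    obtain ⟨ψ, rfl⟩ := hQ.extension_property (LinearMap.range b).subtype
      Subtype.val_injective χ
    exact ⟨ψ, rfl⟩
  · rintro ⟨ψ, rfl⟩
    ext x
    simp [h.apply_apply_eq_zero x]

lemma IDomdimGE.extVanishes {A : Type u} [Ring A] {M : Type u} [AddCommGroup M] [Module A M]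
    (hbaer : Module.Baer (Module.End A M) M) (hact : Function.Bijective (actionMap A M))
    {X : Type u} [AddCommGroup X] [Module A X] (hev : Function.Bijective (homEval A M X))
    {t : ℕ} (h : IDomdimGE (Module.End A M) M (X →ₗ[A] M) t) (i : ℕ) (hi : i + 3 ≤ t) :
    ExtVanishes A X M (i + 1) := by
  obtain ⟨J, g, f, hJ, hg, hgf, hf⟩ := h
  let e := LinearEquiv.ofBijective _ hev
  rw [extVanishes_iff_exact i (fun j => ModuleCat.of A (J j →ₗ[Module.End A M] M))
    (fun j => LinearMap.lcomp A M (f j)) (e.symm.toLinearMap ∘ₗ LinearMap.lcomp A M g)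
    (fun j hj => (hJ j (by lia)).projective_hom_s5 hact)]
  · have hex := hf i hi
    obtain hi1 := (hJ (i + 1) (by lia)).homEval_bijective hact
    obtain hi2 := (hJ (i + 2) (by lia)).homEval_bijective hact
    intro β
    constructor
    · intro hβ
      obtain ⟨j, rfl⟩ := hi1.2 β
      have hj : f (i + 1) j = 0 := by
        apply hi2.1
        ext φ
        exact (LinearMap.congr_fun hβ φ).trans (map_zero φ).symm
      obtain ⟨j', rfl⟩ := (hex j).mp hj
      exact ⟨{ toFun := fun φ => φ j'
               map_add' := fun _ _ => rfl
               map_smul' := fun _ _ => rfl }, rfl⟩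
    · rintro ⟨γ, rfl⟩
      ext φ
      have : (φ ∘ₗ f (i + 1)) ∘ₗ f i = 0 := by
        ext x
        simp [hex.apply_apply_eq_zero x]
      exact (congrArg γ this).trans (map_zero γ)
  · refine e.symm.surjective.comp fun φ => ?_
    exact hbaer.extension_property g (hg (by lia)) φ
  · intro φ
    exact e.symm.map_eq_zero_iff.trans (hbaer.exact_comp (hgf (by lia)) φ)
  · intro j hj
    exact hbaer.exact_comp (hf j (by lia))

/-- A finitely generated module over a left Noetherian ring has a resolution by finitely
generated free modules. -/
lemma exists_finite_free_resolution {A : Type u} [Ring A] [IsNoetherianRing A]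
    (X : Type u) [AddCommGroup X] [Module A X] [Module.Finite A X] :
    ∃ (k : ℕ → ℕ) (d : ∀ i, (Fin (k (i + 1)) → A) →ₗ[A] (Fin (k i) → A))
      (ε : (Fin (k 0) → A) →ₗ[A] X), Function.Surjective ε ∧ Function.Exact (d 0) ε ∧
      ∀ i, Function.Exact (d (i + 1)) (d i) := by
  obtain ⟨k₀, ε, hε⟩ := Module.Finite.exists_fin' A X
  choose k p hp using fun s : Σ k : ℕ, Submodule A (Fin k → A) =>
    Module.Finite.exists_fin' A s.2
  let seq : ℕ → Σ k : ℕ, Submodule A (Fin k → A) := fun i =>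
    Nat.rec ⟨k₀, LinearMap.ker ε⟩ (fun _ s => ⟨k s, LinearMap.ker (p s)⟩) i
  refine ⟨fun i => (seq i).1, fun i => (seq i).2.subtype ∘ₗ p (seq i), ε, hε, ?_, fun i => ?_⟩
  · rw [LinearMap.exact_iff, LinearMap.range_comp,
      LinearMap.range_eq_top.mpr (hp (seq 0)), Submodule.map_top, Submodule.range_subtype]
    rfl
  · rw [LinearMap.exact_iff, LinearMap.range_comp,
      LinearMap.range_eq_top.mpr (hp (seq (i + 1))), Submodule.map_top, Submodule.range_subtype,
      LinearMap.ker_comp_of_ker_eq_bot _ (Submodule.ker_subtype _)]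

lemma inAdd_free_hom (A M : Type u) [Ring A] [AddCommGroup M] [Module A M] (k : ℕ) :
    InAdd (Module.End A M) M ((Fin k → A) →ₗ[A] M) := by
  let ι : ((Fin k → A) →ₗ[A] M) →ₗ[Module.End A M] (Fin k → M) :=
    { toFun := fun f j => f (Pi.single j 1)
      map_add' := fun _ _ => rfl
      map_smul' := fun _ _ => rfl }
  let π : (Fin k → M) →ₗ[Module.End A M] ((Fin k → A) →ₗ[A] M) :=
    ∑ c, LinearMap.lcomp (Module.End A M) M (LinearMap.proj (R := A) (φ := fun _ : Fin k => A) c) ∘ₗ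
      spanSingletonEnd A M ∘ₗ LinearMap.proj c
  refine ⟨k, ι, π, ?_⟩
  ext f j
  simp [ι, π, spanSingletonEnd, Pi.single_apply]

lemma iDomdimGE_of_extVanishes {A : Type u} [Ring A] [IsNoetherianRing A] {M : Type u}
    [AddCommGroup M] [Module A M] {X : Type u} [AddCommGroup X] [Module A X] [Module.Finite A X]
    {t : ℕ} (h : ∀ i, i + 3 ≤ t → ExtVanishes A X M (i + 1)) :
    IDomdimGE (Module.End A M) M (X →ₗ[A] M) t := by
  obtain ⟨k, d, ε, hε, h0, hd⟩ := exists_finite_free_resolution (A := A) X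
  refine ⟨fun i => ModuleCat.of _ ((Fin (k i) → A) →ₗ[A] M),
    LinearMap.lcomp (Module.End A M) M ε, fun i => LinearMap.lcomp (Module.End A M) M (d i),
    fun i _ => inAdd_free_hom A M (k i),
    fun _ => LinearMap.lcomp_injective_of_surjective ε hε, fun _ φ => ?_, fun i hi => ?_⟩
  · constructor
    · intro hφ
      refine LinearMap.exists_comp_eq_of_ker_le hε fun x hx => ?_
      obtain ⟨y, rfl⟩ := (h0 x).mp hx
      exact LinearMap.congr_fun hφ y
    · rintro ⟨ψ, rfl⟩
      refine LinearMap.ext fun x => ?_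
      exact (congrArg ψ (h0.apply_apply_eq_zero x)).trans (map_zero ψ)
  · exact (extVanishes_iff_exact i (fun j => ModuleCat.of A (Fin (k j) → A)) d ε
      (fun j _ => inferInstanceAs (Module.Projective A (Fin (k j) → A))) hε h0
      (fun j _ => hd j)).mp (h i hi)

lemma ENat.sSup_eq_sInf_add_one {D E : ℕ → Prop} (h : ∀ t, D t ↔ ∀ i, i + 3 ≤ t → E (i + 1)) :
    sSup {e : ℕ∞ | ∃ t : ℕ, e = t ∧ D t} =
      sInf {e : ℕ∞ | ∃ i : ℕ, e = i ∧ 1 ≤ i ∧ ¬ E i} + 1 := by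
  classical
  apply le_antisymm
  · refine sSup_le ?_
    rintro _ ⟨t, rfl, ht⟩
    calc (t : ℕ∞) ≤ ((t - 1 : ℕ) : ℕ∞) + 1 := by exact_mod_cast (by lia : t ≤ t - 1 + 1)
      _ ≤ _ := by
        gcongr
        refine le_sInf ?_
        rintro _ ⟨i, rfl, hi, hE⟩
        by_contra hlt
        have hlt' : i < t - 1 := by exact_mod_cast not_le.mp hlt
        obtain ⟨j, rfl⟩ := Nat.exists_eq_add_of_le' hi
        exact hE ((h t).mp ht j (by lia))
  · by_cases hex : ∃ i, ¬ E (i + 1)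
    · have hD : D (Nat.find hex + 2) := (h _).mpr fun i hi =>
        not_not.mp (Nat.find_min hex (by lia))
      refine le_trans (b := ((Nat.find hex + 1 : ℕ) : ℕ∞) + 1) ?_ ?_
      · gcongr
        exact sInf_le ⟨_, rfl, by lia, Nat.find_spec hex⟩
      · exact le_sSup ⟨Nat.find hex + 2, rfl, hD⟩
    · push Not at hex
      have : sSup {e : ℕ∞ | ∃ t : ℕ, e = t ∧ D t} = ⊤ :=
        ENat.eq_top_iff_forall_ge.mpr fun t =>
          le_sSup ⟨t, rfl, (h t).mpr fun i _ => hex i⟩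
      rw [this]
      exact le_top

/-- Under the hypotheses of Theorem 3.3, for every finitely generated
`A`-module `X`, `I`-domdim `Hom_A(X,M) = inf{ i ≥ 1 : Ext^i_A(X,M) ≠ 0 } + 1`
(computed in `ℕ ∪ {∞}`); in particular it is at least `2`. -/
theorem stmt5 (R : Type u) [CommRing R] [IsArtinianRing R]
    (A : Type u) [Ring A] [Algebra R A] [Module.Finite R A]
    (M : Type u) [AddCommGroup M] [Module A M] [Module.Finite A M]
    (n m : ℕ) (hn : 1 ≤ n)
    (hcog : IsCogenerator A M)
    (hext : ∀ i : ℕ, 1 ≤ i → i ≤ n - 1 → ExtVanishes A M M i)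
    (hcodim : MCodimLE A M m) :
    ∀ (X : Type u) [AddCommGroup X] [Module A X], Module.Finite A X →
      IDomdim (Module.End A M) M (X →ₗ[A] M) =
        sInf {e : ℕ∞ | ∃ i : ℕ, e = i ∧ 1 ≤ i ∧ ¬ ExtVanishes A X M i} + 1 ∧
      2 ≤ IDomdim (Module.End A M) M (X →ₗ[A] M) := by
  intro X _ _ _
  have : IsNoetherianRing A := isNoetherian_of_tower R inferInstance
  have : IsNoetherian (Module.End A M) (X →ₗ[A] M) := isNoetherian_end_hom R X
  have : IsNoetherian (Module.End A M) (A →ₗ[A] M) := isNoetherian_end_hom R A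
  have : IsNoetherian (Module.End A M) (Module.End A M) := isNoetherian_end_hom R M
  have key : ∀ t, IDomdimGE (Module.End A M) M (X →ₗ[A] M) t ↔
      ∀ i, i + 3 ≤ t → ExtVanishes A X M (i + 1) := fun t =>
    ⟨fun h => h.extVanishes hcog.baer_end hcog.actionMap_bijective (hcog.homEval_bijective X),
      iDomdimGE_of_extVanishes⟩
  exact ⟨ENat.sSup_eq_sInf_add_one key,
    le_sSup ⟨2, rfl, (key 2).mpr fun i hi => by lia⟩⟩
end

section
/- Let Λ be an Artin algebra, I a finitely generated injective left Λ-module with projective dimension at most m (m ≥ 0), and suppose I-domdim Λ ≥ n+1 for some n ≥ 1. Let A = End_Λ(I) and let M = I viewed as a left A-module. Then M is a cogenerator over A and M-codim A ≤ m. -/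
open CategoryTheory

universe u

/-! ### The functor `Hom_Λ(-, I)` to modules over `End_Λ(I)` -/

section HomDual

variable {Λ : Type u} [Ring Λ] (I : Type u) [AddCommGroup I] [Module Λ I]
  {X Y Z : Type u} [AddCommGroup X] [Module Λ X] [AddCommGroup Y] [Module Λ Y]
  [AddCommGroup Z] [Module Λ Z]

/-- Precomposition with `f`, as an `End_Λ(I)`-linear map `Hom_Λ(Y, I) → Hom_Λ(X, I)`. -/
abbrev homDual (f : X →ₗ[Λ] Y) : (Y →ₗ[Λ] I) →ₗ[Module.End Λ I] (X →ₗ[Λ] I) :=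
  LinearMap.lcomp (Module.End Λ I) I f

/-- The evaluation map from `X` to its bidual `Hom_A(Hom_Λ(X, I), I)`, where `A = End_Λ(I)`. -/
abbrev homBidualEval (Λ : Type u) [Ring Λ] (I X : Type u) [AddCommGroup I] [Module Λ I]
    [AddCommGroup X] [Module Λ X] : X →+ ((X →ₗ[Λ] I) →ₗ[Module.End Λ I] I) :=
  LinearMap.applyₗ' (Module.End Λ I)

variable {I}

/-- An injective module `I` extends any map that vanishes on the kernel. -/
lemma exists_comp_eq_of_ker_le (hI : Module.Injective Λ I) (f : X →ₗ[Λ] Y) (φ : X →ₗ[Λ] I)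
    (h : ∀ x, f x = 0 → φ x = 0) : ∃ ψ : Y →ₗ[Λ] I, ψ ∘ₗ f = φ := by
  have hker : LinearMap.ker f ≤ LinearMap.ker φ := fun x hx => h x hx
  obtain ⟨ψ, hψ⟩ := hI.out ((LinearMap.ker f).liftQ f le_rfl)
    (LinearMap.ker_eq_bot.mp (Submodule.ker_liftQ_eq_bot _ _ _ le_rfl))
    ((LinearMap.ker f).liftQ φ hker)
  exact ⟨ψ, LinearMap.ext fun x => by simpa using hψ (Submodule.Quotient.mk x)⟩

lemma homDual_surjective (hI : Module.Injective Λ I) {f : X →ₗ[Λ] Y}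
    (hf : Function.Injective f) : Function.Surjective (homDual I f) := fun φ =>
  exists_comp_eq_of_ker_le hI f φ fun x hx => by
    rw [(map_eq_zero_iff f hf).mp hx, map_zero]

lemma homDual_injective {f : X →ₗ[Λ] Y} (hf : Function.Surjective f) :
    Function.Injective (homDual I f) := fun _ _ h =>
  LinearMap.ext <| hf.forall.mpr fun x => LinearMap.congr_fun h x

lemma homDual_exact (hI : Module.Injective Λ I) {f : X →ₗ[Λ] Y} {g : Y →ₗ[Λ] Z}
    (h : Function.Exact f g) : Function.Exact (homDual I g) (homDual I f) := by
  intro φ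
  constructor
  · intro hφ
    refine exists_comp_eq_of_ker_le hI g φ fun y hy => ?_
    obtain ⟨x, rfl⟩ := (h y).mp hy
    exact LinearMap.congr_fun hφ x
  · rintro ⟨ψ, rfl⟩
    ext x
    simp [h.apply_apply_eq_zero]

/-- If `X → Y → Z` is exact, `Y` is reflexive and `Z` is torsionless with respect to `I`, then
the second dual of the sequence is exact. -/
lemma homBidual_exact {f : X →ₗ[Λ] Y} {g : Y →ₗ[Λ] Z} (h : Function.Exact f g)
    (hY : Function.Surjective (homBidualEval Λ I Y))
    (hX : Function.Surjective (homBidualEval Λ I X))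
    (hZ : Function.Injective (homBidualEval Λ I Z)) :
    Function.Exact
      (fun ξ : (X →ₗ[Λ] I) →ₗ[Module.End Λ I] I => ξ ∘ₗ homDual I f)
      (fun ξ : (Y →ₗ[Λ] I) →ₗ[Module.End Λ I] I => ξ ∘ₗ homDual I g) := by
  intro ξ
  constructor
  · intro hξ
    obtain ⟨y, rfl⟩ := hY ξ
    have hgy : g y = 0 := hZ (by rw [map_zero]; exact hξ)
    obtain ⟨x, rfl⟩ := (h y).mp hgy
    exact ⟨homBidualEval Λ I X x, rfl⟩
  · rintro ⟨ζ, rfl⟩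
    obtain ⟨x, rfl⟩ := hX ζ
    ext φ
    simp [h.apply_apply_eq_zero]

lemma homBidualEval_bijective_self : Function.Bijective (homBidualEval Λ I I) := by
  refine ⟨fun x y h => LinearMap.congr_fun h LinearMap.id, fun ξ => ⟨ξ LinearMap.id, ?_⟩⟩
  refine LinearMap.ext fun φ => ?_
  exact (ξ.map_smul (φ : Module.End Λ I) LinearMap.id).symm

lemma homBidualEval_bijective_pi (hX : Function.Bijective (homBidualEval Λ I X)) (k : ℕ) :
    Function.Bijective (homBidualEval Λ I (Fin k → X)) := by
  constructor
  · intro v w h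
    ext j
    exact hX.1 (LinearMap.ext fun φ => LinearMap.congr_fun h (φ ∘ₗ LinearMap.proj j))
  · intro ξ
    choose y hy using fun j => hX.2 (ξ ∘ₗ homDual I (LinearMap.proj j))
    refine ⟨y, LinearMap.ext fun φ => ?_⟩
    have hφ : φ = ∑ j, homDual I (LinearMap.proj j)
        (φ ∘ₗ LinearMap.single Λ (fun _ : Fin k => X) j) := by
      ext j x
      simp [Pi.single_apply, apply_ite]
    conv_rhs => rw [hφ, map_sum]
    conv_lhs => rw [hφ, map_sum]
    exact Finset.sum_congr rfl fun j _ => LinearMap.congr_fun (hy j)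
      (φ ∘ₗ LinearMap.single Λ (fun _ : Fin k => X) j)

lemma homBidualEval_bijective_of_retract (hY : Function.Bijective (homBidualEval Λ I Y))
    (ι : X →ₗ[Λ] Y) (π : Y →ₗ[Λ] X) (h : π ∘ₗ ι = LinearMap.id) :
    Function.Bijective (homBidualEval Λ I X) := by
  have hπ : ∀ x, π (ι x) = x := LinearMap.congr_fun h
  constructor
  · intro x y hxy
    have : ι x = ι y := hY.1 (LinearMap.ext fun φ => LinearMap.congr_fun hxy (φ ∘ₗ ι))
    rw [← hπ x, this, hπ]
  · intro ξ
    obtain ⟨y, hy⟩ := hY.2 (ξ ∘ₗ homDual I ι)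
    refine ⟨π y, LinearMap.ext fun φ => ?_⟩
    have := LinearMap.congr_fun hy (φ ∘ₗ π)
    simpa [LinearMap.lcomp_apply', LinearMap.comp_assoc, h] using this

lemma InAdd.homBidualEval_bijective (h : InAdd Λ X Y)
    (hX : Function.Bijective (homBidualEval Λ I X)) :
    Function.Bijective (homBidualEval Λ I Y) := by
  obtain ⟨k, ι, π, hπ⟩ := h
  exact homBidualEval_bijective_of_retract (homBidualEval_bijective_pi hX k) ι π hπ

lemma homBidualEval_bijective_of_exact (hI : Module.Injective Λ I) {f : X →ₗ[Λ] Y}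
    {g : Y →ₗ[Λ] Z} (hf : Function.Injective f) (h : Function.Exact f g)
    (hY : Function.Bijective (homBidualEval Λ I Y))
    (hZ : Function.Injective (homBidualEval Λ I Z)) :
    Function.Bijective (homBidualEval Λ I X) := by
  constructor
  · intro x y hxy
    exact hf (hY.1 (LinearMap.ext fun φ => LinearMap.congr_fun hxy (φ ∘ₗ f)))
  · intro ξ
    obtain ⟨y, hy⟩ := hY.2 (ξ ∘ₗ homDual I f)
    have hgy : g y = 0 := hZ <| by
      ext φ
      have := LinearMap.congr_fun hy (φ ∘ₗ g)
      simpa [LinearMap.lcomp_apply', LinearMap.comp_assoc, h.linearMap_comp_eq_zero] using this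
    obtain ⟨x, rfl⟩ := (h y).mp hgy
    refine ⟨x, LinearMap.ext <| (homDual_surjective hI hf).forall.mpr fun φ => ?_⟩
    exact LinearMap.congr_fun hy φ

/-- Homomorphisms out of `Λ ^ k` form `I ^ k` as an `End_Λ(I)`-module. -/
def finFreeHomEquiv {k : ℕ} : ((Fin k → Λ) →ₗ[Λ] I) ≃ₗ[Module.End Λ I] (Fin k → I) :=
  (LinearMap.lsum Λ (fun _ => Λ) (Module.End Λ I)).symm ≪≫ₗ
    LinearEquiv.piCongrRight fun _ => LinearMap.ringLmapEquivSelf Λ (Module.End Λ I) I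

lemma InAdd.homDual (h : InAdd Λ Λ X) : InAdd (Module.End Λ I) I (X →ₗ[Λ] I) := by
  obtain ⟨k, ι, π, hπ⟩ := h
  refine ⟨k, finFreeHomEquiv.toLinearMap ∘ₗ _root_.homDual I π,
    _root_.homDual I ι ∘ₗ finFreeHomEquiv.symm.toLinearMap, ?_⟩
  ext φ x
  simpa using congrArg φ (LinearMap.congr_fun hπ x)

lemma inAdd_of_finite_projective [Module.Finite Λ X] [Module.Projective Λ X] : InAdd Λ Λ X := by
  obtain ⟨k, π, hπ⟩ := Module.Finite.exists_fin' Λ X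
  obtain ⟨ι, hι⟩ := Module.projective_lifting_property π LinearMap.id hπ
  exact ⟨k, ι, π, hι⟩

end HomDual

/-! ### Finitely generated projective resolutions -/

lemma ProjDimLE.hasProjectiveDimensionLE {Λ : Type u} [Ring Λ] {m : ℕ} {N : Type u}
    [AddCommGroup N] [Module Λ N] (h : ProjDimLE Λ N m) :
    HasProjectiveDimensionLE (ModuleCat.of Λ N) m := by
  induction m generalizing N with
  | zero =>
    obtain ⟨P, f, g, hP, hs, hg, h0, -⟩ := h
    have := hs 1 one_pos
    have hinj : Function.Injective g := by
      rw [injective_iff_map_eq_zero]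
      intro x hx
      obtain ⟨y, rfl⟩ := (h0 x).mp hx
      rw [Subsingleton.elim y 0, map_zero]
    have := hP 0
    have : Module.Projective Λ N := .of_equiv (LinearEquiv.ofBijective g ⟨hinj, hg⟩)
    exact (projective_iff_hasProjectiveDimensionLE_zero _).mp
      ((IsProjective.iff_projective N).mp this)
  | succ m ih =>
    obtain ⟨P, f, g, hP, hs, hg, h0, h1⟩ := h
    have hker : ∀ x, f 0 x ∈ LinearMap.ker g := h0.apply_apply_eq_zero
    have hK : ProjDimLE Λ (LinearMap.ker g) m := by
      refine ⟨fun i => P (i + 1), fun i => f (i + 1), (f 0).codRestrict _ hker,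
        fun i => hP _, fun i hi => hs _ (by omega), ?_, ?_, fun i => h1 _⟩
      · rintro ⟨x, hx⟩
        obtain ⟨y, rfl⟩ := (h0 x).mp hx
        exact ⟨y, rfl⟩
      · intro x
        rw [← h1 0 x, Subtype.ext_iff]
        rfl
    have hP0 : Projective (ModuleCat.of Λ (P 0)) := (IsProjective.iff_projective _).mp (hP 0)
    exact ((LinearMap.shortExact_shortComplexKer hg).hasProjectiveDimensionLT_X₃_iff m hP0).mpr
      (ih hK)

/-- Over a left noetherian ring, a finitely generated module of projective dimension at most `m`
has a resolution of length `m` by finitely generated projective modules. -/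
lemma exists_finite_projective_resolution {Λ : Type u} [Ring Λ] [IsNoetherianRing Λ] {m : ℕ}
    (N : Type u) [AddCommGroup N] [Module Λ N] [Module.Finite Λ N]
    (h : HasProjectiveDimensionLE (ModuleCat.of Λ N) m) :
    ∃ (P : ℕ → ModuleCat.{u} Λ) (f : ∀ i, (P (i + 1) : Type u) →ₗ[Λ] P i)
      (g : (P 0 : Type u) →ₗ[Λ] N),
      (∀ i, Module.Finite Λ (P i) ∧ Module.Projective Λ (P i)) ∧
      (∀ i, m < i → Subsingleton (P i)) ∧
      Function.Surjective g ∧ Function.Exact (f 0) g ∧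
      (∀ i, Function.Exact (f (i + 1)) (f i)) := by
  induction m generalizing N with
  | zero =>
    have hN : Module.Projective Λ N :=
      (IsProjective.iff_projective N).mpr ((projective_iff_hasProjectiveDimensionLE_zero _).mpr h)
    let P : ℕ → ModuleCat.{u} Λ
      | 0 => ModuleCat.of Λ N
      | _ + 1 => ModuleCat.of Λ PUnit.{u + 1}
    have hs : ∀ i, Subsingleton (P (i + 1)) := fun _ => inferInstanceAs (Subsingleton PUnit.{u + 1})
    refine ⟨P, fun _ => 0, LinearMap.id, ?_, ?_, Function.surjective_id, ?_, ?_⟩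
    · rintro (_ | i)
      · exact ⟨‹_›, hN⟩
      · exact ⟨inferInstanceAs (Module.Finite Λ PUnit.{u + 1}),
          inferInstanceAs (Module.Projective Λ PUnit.{u + 1})⟩
    · rintro (_ | i) hi
      · omega
      · exact hs i
    · intro x
      exact ⟨fun hx => ⟨0, hx.symm⟩, fun ⟨_, hx⟩ => hx.symm⟩
    · intro i x
      exact ⟨fun _ => ⟨0, (hs i).elim _ _⟩, fun _ => rfl⟩
  | succ m ih =>
    obtain ⟨k, q, hq⟩ := Module.Finite.exists_fin' Λ N
    have hF : Projective (ModuleCat.of Λ (Fin k → Λ)) :=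
      (IsProjective.iff_projective _).mp inferInstance
    obtain ⟨P, f, g, hP, hs, hg, h0, h1⟩ := ih (LinearMap.ker q)
      (((LinearMap.shortExact_shortComplexKer hq).hasProjectiveDimensionLT_X₃_iff m hF).mp h)
    let P' : ℕ → ModuleCat.{u} Λ
      | 0 => ModuleCat.of Λ (Fin k → Λ)
      | i + 1 => P i
    let f' : ∀ i, (P' (i + 1) : Type u) →ₗ[Λ] P' i
      | 0 => (LinearMap.ker q).subtype ∘ₗ g
      | i + 1 => f i
    refine ⟨P', f', q, ?_, ?_, hq, ?_, ?_⟩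
    · rintro (_ | i)
      · exact ⟨inferInstanceAs (Module.Finite Λ (Fin k → Λ)),
          inferInstanceAs (Module.Projective Λ (Fin k → Λ))⟩
      · exact hP i
    · rintro (_ | i) hi
      · omega
      · exact hs i (by omega)
    · intro x
      constructor
      · intro hx
        obtain ⟨y, hy⟩ := hg ⟨x, hx⟩
        exact ⟨y, congrArg Subtype.val hy⟩
      · rintro ⟨y, rfl⟩
        exact (g y).2
    · rintro (_ | i) x
      · rw [← h0 x, Subtype.ext_iff]
        rfl
      · exact h1 i x

/-! ### The cogenerator property and the codimension -/

/-- The endomorphism ring of a finitely generated module over an Artin algebra is noetherian. -/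
lemma isNoetherianRing_end (R : Type u) [CommRing R] [IsNoetherianRing R] (Λ : Type u) [Ring Λ]
    [Algebra R Λ] [Module.Finite R Λ] (I : Type u) [AddCommGroup I] [Module Λ I]
    [Module.Finite Λ I] : IsNoetherianRing (Module.End Λ I) := by
  let : Module R I := Module.compHom I (algebraMap R Λ)
  have : IsScalarTower R Λ I := .of_algebraMap_smul fun _ _ => rfl
  have : Module.Finite R I := .trans Λ I
  have : IsNoetherian R (I →ₗ[Λ] I) :=
    isNoetherian_of_injective (LinearMap.restrictScalarsₗ R Λ I I R)
      (LinearMap.restrictScalars_injective R)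
  exact isNoetherian_of_tower R this

/-- If `I` is injective, every finitely presented `End_Λ(I)`-module is of the form `Hom_Λ(K, I)`
with `K` a submodule of some `I ^ k`, so it embeds into a power of `I` when `K` is finitely
generated. -/
lemma isCogenerator_end {Λ : Type u} [Ring Λ] [IsNoetherianRing Λ] {I : Type u} [AddCommGroup I]
    [Module Λ I] [Module.Finite Λ I] [IsNoetherianRing (Module.End Λ I)]
    (hI : Module.Injective Λ I) : IsCogenerator (Module.End Λ I) I := by
  intro X _ _ hX
  have := (Module.finitePresentation_iff_finite (Module.End Λ I) X).mpr hX
  obtain ⟨k, l, p, r, hp, hr⟩ := Module.FinitePresentation.exists_fin' (Module.End Λ I) X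
  let A := Module.End Λ I
  let e (k : ℕ) : (Fin k → A) ≃ₗ[A] ((Fin k → I) →ₗ[Λ] I) :=
    LinearMap.lsum Λ (fun _ : Fin k => I) A
  let d : (Fin k → I) →ₗ[Λ] (Fin l → I) := LinearMap.pi fun j => e k (r (Pi.single j 1))
  have hd : ∀ v : Fin l → A, homDual I d (e l v) = e k (r v) := by
    intro v
    refine LinearMap.congr_fun (f := homDual I d ∘ₗ (e l).toLinearMap)
      (g := (e k).toLinearMap ∘ₗ r) ((Pi.basisFun A (Fin l)).ext fun j => ?_) v
    have hj : e l (Pi.single j 1) = LinearMap.proj j := by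
      refine LinearMap.ext fun x => ?_
      simp only [e, LinearMap.lsum_apply, LinearMap.sum_apply, LinearMap.comp_apply,
        LinearMap.proj_apply]
      rw [Finset.sum_eq_single j (fun i _ hi => by rw [Pi.single_eq_of_ne hi]; rfl) (by simp),
        Pi.single_eq_same]
      rfl
    rw [Pi.basisFun_apply]
    exact congrArg (homDual I d) hj
  obtain ⟨s, q, hq⟩ := Module.Finite.exists_fin' Λ (LinearMap.ker d)
  let c : (Fin s → Λ) →ₗ[Λ] (Fin k → I) := (LinearMap.ker d).subtype ∘ₗ q
  have hcd : Function.Exact c d := by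
    intro x
    constructor
    · intro hx
      obtain ⟨y, hy⟩ := hq ⟨x, hx⟩
      exact ⟨y, congrArg Subtype.val hy⟩
    · rintro ⟨y, rfl⟩
      exact (q y).2
  have hker : ∀ v, homDual I c (e k v) = 0 ↔ p v = 0 := by
    intro v
    rw [homDual_exact hI hcd, hr v]
    constructor
    · rintro ⟨φ, hφ⟩
      refine ⟨(e l).symm φ, (e k).injective ?_⟩
      rw [← hd, LinearEquiv.apply_symm_apply, hφ]
    · rintro ⟨w, rfl⟩
      exact ⟨e l w, hd w⟩
  let F : (Fin k → A) →ₗ[A] (Fin s → I) :=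
    finFreeHomEquiv.toLinearMap ∘ₗ homDual I c ∘ₗ (e k).toLinearMap
  have hF : LinearMap.ker F = LinearMap.ker p := by
    ext v
    rw [LinearMap.mem_ker, LinearMap.mem_ker, ← hker]
    exact (finFreeHomEquiv (Λ := Λ) (I := I) (k := s)).map_eq_zero_iff (x := homDual I c (e k v))
  refine ⟨s, (LinearMap.ker p).liftQ F hF.ge ∘ₗ
    (p.quotKerEquivOfSurjective hp).symm.toLinearMap, ?_⟩
  rw [LinearMap.coe_comp]
  exact (LinearMap.ker_eq_bot.mp (Submodule.ker_liftQ_eq_bot _ _ _ hF.le)).comp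
    (LinearEquiv.injective _)

/-- If `Λ` is reflexive with respect to the injective module `I`, the `I`-dual of a finitely
generated projective resolution of `I` computes the `I`-codimension of `End_Λ(I)`. -/
lemma mCodimLE_end {Λ : Type u} [Ring Λ] [IsNoetherianRing Λ] {I : Type u} [AddCommGroup I]
    [Module Λ I] [Module.Finite Λ I] (hI : Module.Injective Λ I) {m : ℕ}
    (hpd : ProjDimLE Λ I m) (hΛ : Function.Bijective (homBidualEval Λ I Λ)) :
    MCodimLE (Module.End Λ I) I m := by
  obtain ⟨P, f, g, hP, hs, hg, h0, h1⟩ :=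
    exists_finite_projective_resolution I hpd.hasProjectiveDimensionLE
  have hadd : ∀ i, InAdd Λ Λ (P i) := fun i =>
    have := (hP i).1
    have := (hP i).2
    inAdd_of_finite_projective
  have hrefl : ∀ i, Function.Bijective (homBidualEval Λ I (P i)) := fun i =>
    (hadd i).homBidualEval_bijective hΛ
  refine ⟨fun i => ModuleCat.of _ ((P i : Type u) →ₗ[Λ] I), homDual I g,
    fun i => homDual I (f i), fun i _ => (hadd i).homDual, fun i hi => ?_,
    homDual_injective hg, homDual_exact hI h0, fun i => homDual_exact hI (h1 i), ?_,
    homBidual_exact h0 (hrefl 0).2 (hrefl 1).2 homBidualEval_bijective_self.1,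
    fun i => homBidual_exact (h1 i) (hrefl (i + 1)).2 (hrefl (i + 2)).2 (hrefl i).1⟩
  · have := hs i hi
    exact ⟨fun φ ψ => LinearMap.ext fun x => by
      rw [Subsingleton.elim x 0, map_zero, map_zero]⟩
  · intro ψ
    obtain ⟨x, rfl⟩ := homBidualEval_bijective_self.2 ψ
    obtain ⟨y, rfl⟩ := hg x
    exact ⟨homBidualEval Λ I (P 0) y, rfl⟩

/-- If `I` is a finitely generated injective module over the Artin algebra `Λ`
with projective dimension at most `m` and `I`-domdim `Λ ≥ n+1` (`n ≥ 1`), then `I`, viewed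
as a module over `A = End_Λ(I)` via evaluation, is a cogenerator with `I`-codim `A ≤ m`. -/
theorem stmt6 (R : Type u) [CommRing R] [IsArtinianRing R]
    (Λ : Type u) [Ring Λ] [Algebra R Λ] [Module.Finite R Λ]
    (I : Type u) [AddCommGroup I] [Module Λ I] [Module.Finite Λ I]
    (hIinj : Module.Injective Λ I)
    (m n : ℕ) (hn : 1 ≤ n)
    (hpd : ProjDimLE Λ I m)
    (hdom : IDomdimGE Λ I Λ (n + 1)) :
    IsCogenerator (Module.End Λ I) I ∧ MCodimLE (Module.End Λ I) I m := by
  have : IsNoetherian R Λ := isNoetherian_of_isNoetherianRing_of_finite R Λ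
  have : IsNoetherianRing Λ := isNoetherian_of_tower R ‹_›
  have := isNoetherianRing_end R Λ I
  refine ⟨isCogenerator_end hIinj, mCodimLE_end hIinj hpd ?_⟩
  obtain ⟨J, g, f, hJ, hg, hgf, -⟩ := hdom
  have hrefl : ∀ i < n + 1, Function.Bijective (homBidualEval Λ I (J i)) := fun i hi =>
    (hJ i hi).homBidualEval_bijective homBidualEval_bijective_self
  exact homBidualEval_bijective_of_exact hIinj (hg (by omega)) (hgf (by omega))
    (hrefl 0 (by omega)) (hrefl 1 (by omega)).1
end

section
/- Let Λ be an Artin algebra, I a finitely generated injective left Λ-module with projective dimension at most m (m ≥ 0), and suppose I-domdim Λ ≥ n+1 for some n ≥ 1. Let A = End_Λ(I). Then the canonical ring homomorphism Λ → End_A(I), sending λ ∈ Λ to the map x ↦ λ·x (which is A-linear since the Λ-action and the End_Λ(I)-action on I commute), is an isomorphism. -/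
open CategoryTheory

universe u

/-- An endomorphism of `I` over `End_Λ(I)`, applied componentwise, commutes with `Λ`-linear maps
out of finite powers of `I`. -/
theorem map_comp_apply_of_doubleEnd {Λ : Type*} [Ring Λ] {I : Type*} [AddCommGroup I] [Module Λ I]
    {ι : Type*} [Finite ι] (h : Module.End (Module.End Λ I) I) (T : (ι → I) →ₗ[Λ] I) (v : ι → I) :
    T (fun i => h (v i)) = h (T v) := by
  classical
  have := Fintype.ofFinite ι
  have key (w : ι → I) : T w = ∑ i, (T ∘ₗ LinearMap.single Λ (fun _ => I) i) • w i := by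
    conv_lhs => rw [← Finset.univ_sum_single w, map_sum]
    rfl
  rw [key, key v, map_sum]
  simp only [map_smul]

/-- If `Λ` is the kernel of a map from a summand of `I^k` to a module in `add I`, then some element
of `Λ` acts as a given endomorphism of `I` over `End_Λ(I)` on the image of `1` in `I^k`. -/
theorem exists_smul_eq_doubleEnd {Λ : Type*} [Ring Λ] {I : Type*} [AddCommGroup I] [Module Λ I]
    {J₀ J₁ : Type*} [AddCommGroup J₀] [Module Λ J₀] [AddCommGroup J₁] [Module Λ J₁]
    {κ₀ κ₁ : Type*} [Finite κ₀]
    {s : J₀ →ₗ[Λ] (κ₀ → I)} {p : (κ₀ → I) →ₗ[Λ] J₀} (hp : p ∘ₗ s = LinearMap.id)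
    {t : J₁ →ₗ[Λ] (κ₁ → I)} (ht : Function.Injective t)
    {g : Λ →ₗ[Λ] J₀} {f : J₀ →ₗ[Λ] J₁} (hex : Function.Exact g f)
    (h : Module.End (Module.End Λ I) I) :
    ∃ a : Λ, ∀ i, h (s (g 1) i) = a • s (g 1) i := by
  have hp' (x : J₀) : p (s x) = x := LinearMap.congr_fun hp x
  set v : κ₀ → I := fun i => h (s (g 1) i) with hv
  have hsp : s (p v) = v := by
    ext i
    simpa [hp'] using
      map_comp_apply_of_doubleEnd h (LinearMap.proj i ∘ₗ s ∘ₗ p) (s (g 1))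
  have hf : f (p v) = 0 := by
    apply ht
    ext i
    simpa [hp', hex.apply_apply_eq_zero] using
      map_comp_apply_of_doubleEnd h (LinearMap.proj i ∘ₗ t ∘ₗ f ∘ₗ p) (s (g 1))
  obtain ⟨a, ha⟩ := (hex _).mp hf
  refine ⟨a, fun i => ?_⟩
  have hga : g a = a • g 1 := by rw [← map_smul, smul_eq_mul, mul_one]
  calc h (s (g 1) i) = s (p v) i := by rw [hsp]
    _ = a • s (g 1) i := by rw [← ha, hga, map_smul, Pi.smul_apply]

/-- If `I` is a finitely generated injective module over the Artin algebra `Λ`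
with projective dimension at most `m` and `I`-domdim `Λ ≥ n+1` (`n ≥ 1`), then the canonical
ring homomorphism `Λ → End_A(I)`, where `A = End_Λ(I)`, is an isomorphism. -/
theorem stmt8 (R : Type u) [CommRing R] [IsArtinianRing R]
    (Λ : Type u) [Ring Λ] [Algebra R Λ] [Module.Finite R Λ]
    (I : Type u) [AddCommGroup I] [Module Λ I] [Module.Finite Λ I]
    (hIinj : Module.Injective Λ I)
    (m n : ℕ) (hn : 1 ≤ n)
    (hpd : ProjDimLE Λ I m)
    (hdom : IDomdimGE Λ I Λ (n + 1)) :
    Function.Bijective (evalRingHom Λ I) := by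
  obtain ⟨J, g, f, hadd, hg, hex, -⟩ := hdom
  replace hg := hg (by lia)
  replace hex := hex (by lia)
  obtain ⟨k, s, p, hp⟩ := hadd 0 (by lia)
  obtain ⟨l, t, q, hq⟩ := hadd 1 (by lia)
  have hs : Function.Injective s :=
    Function.LeftInverse.injective (g := p) (LinearMap.congr_fun hp)
  have ht : Function.Injective t :=
    Function.LeftInverse.injective (g := q) (LinearMap.congr_fun hq)
  have hga (a : Λ) : g a = a • g 1 := by rw [← map_smul, smul_eq_mul, mul_one]
  constructor
  · rw [injective_iff_map_eq_zero]
    intro a ha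
    apply hg
    apply hs
    ext i
    have := LinearMap.congr_fun ha (s (g 1) i)
    simpa [hga a] using this
  · intro h
    obtain ⟨a, ha⟩ := exists_smul_eq_doubleEnd hp ht hex h
    refine ⟨a, LinearMap.ext fun x => ?_⟩
    obtain ⟨T, hT⟩ := hIinj.out (s ∘ₗ g) (hs.comp hg) (LinearMap.toSpanSingleton Λ I x)
    have hT1 : T (s (g 1)) = x := by simpa using hT 1
    calc a • x = T (a • s (g 1)) := by rw [map_smul, hT1]
      _ = T (fun i => h (s (g 1) i)) := congrArg T (funext fun i => (ha i).symm)
      _ = h x := by rw [map_comp_apply_of_doubleEnd, hT1]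
end
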